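/- arXiv:2508.05712 — 7 statements merged into one kernel-verified Lean document; each statement's English description precedes it below -/
import Mathlib

section
/- Correctness of QVI-2/QVI-3 (deterministic core, assuming all mean estimates meet their one-sided error guarantees): Let M be a finite-horizon time-dependent MDP and ε ∈ (0, H]. Suppose V̂_H = 0 and, for h = H−1 down to 0: real numbers z_{h,s}(a) satisfy Σ_{s'∈S} P_h(s'|s,a) V̂_{h+1}(s') − ε/H ≤ z_{h,s}(a) ≤ Σ_{s'∈S} P_h(s'|s,a) V̂_{h+1}(s') for all (s,a) ∈ S×A; Q̂_{h,s}(a) = max{r_h(s,a) + z_{h,s}(a), 0}; π̂(s,h) is a maximizer of a ↦ Q̂_{h,s}(a); and V̂_h(s) = Q̂_{h,s}(π̂(s,h)). Then for every h ∈ {0,…,H−1}: V_h^* − ε ≤ V̂_h ≤ V_h^{π̂} ≤ V_h^* (componentwise). -/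
open Finset

variable {S A : Type*}

/-- Value function of a policy in a finite-horizon time-dependent MDP. -/
noncomputable def Vpi [Fintype S] (H : ℕ) (P : ℕ → S → A → S → ℝ)
    (r : ℕ → S → A → ℝ) (π : S → ℕ → A) (h : ℕ) (s : S) : ℝ :=
  if _hlt : h < H then
    r h s (π s h) + ∑ s' : S, P h s (π s h) s' * Vpi H P r π (h + 1) s'
  else 0
termination_by H - h
decreasing_by omega

/-- Q-value function of a policy. -/
noncomputable def Qpi [Fintype S] (H : ℕ) (P : ℕ → S → A → S → ℝ)
    (r : ℕ → S → A → ℝ) (π : S → ℕ → A) (h : ℕ) (s : S) (a : A) : ℝ :=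
  r h s a + ∑ s' : S, P h s a s' * Vpi H P r π (h + 1) s'

/-- Optimal value function: maximum over all policies. -/
noncomputable def Vstar [Fintype S] (H : ℕ) (P : ℕ → S → A → S → ℝ)
    (r : ℕ → S → A → ℝ) (h : ℕ) (s : S) : ℝ :=
  ⨆ π : S → ℕ → A, Vpi H P r π h s

/-- Optimal Q-value function: maximum over all policies. -/
noncomputable def Qstar [Fintype S] (H : ℕ) (P : ℕ → S → A → S → ℝ)
    (r : ℕ → S → A → ℝ) (h : ℕ) (s : S) (a : A) : ℝ :=
  ⨆ π : S → ℕ → A, Qpi H P r π h s a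

/-- Policy value operator. -/
noncomputable def Tpol [Fintype S] (P : ℕ → S → A → S → ℝ) (r : ℕ → S → A → ℝ)
    (π : S → ℕ → A) (h : ℕ) (u : S → ℝ) (s : S) : ℝ :=
  r h s (π s h) + ∑ s' : S, P h s (π s h) s' * u s'

/-- **Correctness of QVI-2/QVI-3 (deterministic core).**
Assuming all mean estimates `z` meet their one-sided error guarantees, the outputs of
approximate backward induction with the monotonicity technique satisfy
`V⋆ h − ε ≤ V̂ h ≤ V^{π̂} h ≤ V⋆ h` componentwise for every `h < H`. -/
theorem qvi2_qvi3_correct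
    {S A : Type*} [Fintype S] [Fintype A] [Nonempty S] [Nonempty A]
    (H : ℕ) (hH : 0 < H)
    (P : ℕ → S → A → S → ℝ) (r : ℕ → S → A → ℝ)
    (hP : ∀ h < H, ∀ (s : S) (a : A), (∀ s' : S, 0 ≤ P h s a s') ∧ ∑ s' : S, P h s a s' = 1)
    (hr : ∀ h < H, ∀ (s : S) (a : A), 0 ≤ r h s a ∧ r h s a ≤ 1)
    (ε : ℝ) (hε : 0 < ε) (hεH : ε ≤ H)
    (z : ℕ → S → A → ℝ) (Qhat : ℕ → S → A → ℝ) (Vhat : ℕ → S → ℝ) (πhat : S → ℕ → A)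
    (hVH : ∀ s : S, Vhat H s = 0)
    (hz : ∀ h < H, ∀ (s : S) (a : A),
      (∑ s' : S, P h s a s' * Vhat (h + 1) s') - ε / H ≤ z h s a ∧
      z h s a ≤ ∑ s' : S, P h s a s' * Vhat (h + 1) s')
    (hQdef : ∀ h < H, ∀ (s : S) (a : A), Qhat h s a = max (r h s a + z h s a) 0)
    (hmax : ∀ h < H, ∀ (s : S) (a : A), Qhat h s a ≤ Qhat h s (πhat s h))
    (hVdef : ∀ h < H, ∀ s : S, Vhat h s = Qhat h s (πhat s h)) :
    ∀ h < H, ∀ s : S,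
      Vstar H P r h s - ε ≤ Vhat h s ∧
      Vhat h s ≤ Vpi H P r πhat h s ∧
      Vpi H P r πhat h s ≤ Vstar H P r h s := by
  have hH' : (0:ℝ) < H := by exact_mod_cast hH
  have key : ∀ k ≤ H, ∀ s : S, 0 ≤ Vhat (H - k) s ∧
      Vhat (H - k) s ≤ Vpi H P r πhat (H - k) s ∧
      ∀ π : S → ℕ → A, Vpi H P r π (H - k) s ≤ Vhat (H - k) s + k * (ε / H) := by
    intro k
    induction k with
    | zero =>
      intro _ s
      have h0 : ∀ π : S → ℕ → A, Vpi H P r π H s = 0 := by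
        intro π
        rw [Vpi]
        simp
      simp [hVH, h0]
    | succ k ih =>
      intro hk s
      have ih' := ih (by omega)
      obtain ⟨h, hh⟩ : ∃ h, h = H - (k + 1) := ⟨_, rfl⟩
      have e : H - k = h + 1 := by omega
      have hlt : h < H := by omega
      rw [← hh]
      rw [e] at ih'
      have hV : ∀ π : S → ℕ → A, Vpi H P r π h s =
          r h s (π s h) + ∑ s' : S, P h s (π s h) s' * Vpi H P r π (h + 1) s' := by
        intro π
        conv_lhs => rw [Vpi]
        simp [hlt]
      have hv := hVdef h hlt s
      have hq := hQdef h hlt s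
      refine ⟨?_, ?_, ?_⟩
      · rw [hv, hq]
        exact le_max_right _ _
      · have h1 : ∑ s' : S, P h s (πhat s h) s' * Vhat (h + 1) s' ≤
            ∑ s' : S, P h s (πhat s h) s' * Vpi H P r πhat (h + 1) s' :=
          Finset.sum_le_sum fun s' _ =>
            mul_le_mul_of_nonneg_left (ih' s').2.1 ((hP h hlt s _).1 s')
        have h2 : 0 ≤ ∑ s' : S, P h s (πhat s h) s' * Vhat (h + 1) s' :=
          Finset.sum_nonneg fun s' _ => mul_nonneg ((hP h hlt s _).1 s') (ih' s').1
        have h3 := (hz h hlt s (πhat s h)).2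
        have h4 := (hr h hlt s (πhat s h)).1
        rw [hv, hq, hV]
        apply max_le <;> linarith
      · intro π
        have h1 : ∑ s' : S, P h s (π s h) s' * Vpi H P r π (h + 1) s' ≤
            ∑ s' : S, P h s (π s h) s' * (Vhat (h + 1) s' + k * (ε / H)) :=
          Finset.sum_le_sum fun s' _ =>
            mul_le_mul_of_nonneg_left ((ih' s').2.2 π) ((hP h hlt s _).1 s')
        simp only [mul_add] at h1
        rw [Finset.sum_add_distrib, ← Finset.sum_mul, (hP h hlt s _).2, one_mul] at h1
        have h3 := (hz h hlt s (π s h)).1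
        have h4 := hmax h hlt s (π s h)
        have h5 := le_max_left (r h s (π s h) + z h s (π s h)) 0
        rw [← hq] at h5
        rw [hv, hV]
        push_cast
        linarith
  intro h hlt s
  have e : H - (H - h) = h := by omega
  have hk := key (H - h) (by omega) s
  rw [e] at hk
  obtain ⟨-, h2, h3⟩ := hk
  have hb : ((H - h : ℕ) : ℝ) * (ε / H) ≤ ε := by
    have h6 : ((H - h : ℕ) : ℝ) ≤ H := by exact_mod_cast Nat.sub_le H h
    calc ((H - h : ℕ) : ℝ) * (ε / H) ≤ H * (ε / H) :=
          mul_le_mul_of_nonneg_right h6 (by positivity)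
      _ = ε := by field_simp
  haveI : Nonempty (S → ℕ → A) := ⟨πhat⟩
  refine ⟨?_, h2, ?_⟩
  · have : Vstar H P r h s ≤ Vhat h s + ε := ciSup_le fun π => (h3 π).trans (by linarith)
    linarith
  · exact le_ciSup (f := fun π : S → ℕ → A => Vpi H P r π h s)
      ⟨_, by rintro _ ⟨π, rfl⟩; exact h3 π⟩ πhat
end

section
/- Monotone property of the QVI-4 iterates: Suppose the QVI-4 iterates are formed with offsets satisfying, for all k ∈ {0,…,K−1}, h ∈ {0,…,H−1} and (s,a) ∈ S×A: x_{k,h}(s,a) ≤ (P_h V^{(0)}_{k,h+1})(s,a) and g_{k,h}(s,a) ≤ (P_h (V_{k,h+1} − V^{(0)}_{k,h+1}))(s,a). Then for all k ∈ {0,…,K−1} and h ∈ {0,…,H−1}: V_{k,h} ≤ V_h^{π_k} ≤ V_h^* and Q_{k,h} ≤ Q_h^{π_k} ≤ Q_h^* (componentwise). -/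
open Finset

variable {S A : Type*}

theorem Vpi_bdd_aux {S A : Type*} [Fintype S] (H : ℕ)
    (P : ℕ → S → A → S → ℝ) (r : ℕ → S → A → ℝ)
    (hP : ∀ h < H, ∀ (s : S) (a : A), (∀ s' : S, 0 ≤ P h s a s') ∧ ∑ s' : S, P h s a s' = 1)
    (hr : ∀ h < H, ∀ (s : S) (a : A), 0 ≤ r h s a ∧ r h s a ≤ 1)
    (π : S → ℕ → A) : ∀ (n h : ℕ), h + n = H → ∀ s, Vpi H P r π h s ≤ n := by
  intro n
  induction n with
  | zero =>
    intro h hh s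
    rw [Vpi, dif_neg (by omega)]
    simp
  | succ n ih =>
    intro h hh s
    have hlt : h < H := by omega
    rw [Vpi, dif_pos hlt]
    have h1 : ∑ s' : S, P h s (π s h) s' * Vpi H P r π (h + 1) s'
        ≤ ∑ s' : S, P h s (π s h) s' * (n : ℝ) :=
      Finset.sum_le_sum fun s' _ =>
        mul_le_mul_of_nonneg_left (ih (h + 1) (by omega) s') ((hP h hlt s _).1 s')
    rw [← Finset.sum_mul, (hP h hlt s _).2, one_mul] at h1
    have h2 := (hr h hlt s (π s h)).2
    push_cast
    linarith

/-- **Monotone property of the QVI-4 iterates.**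
If the offsets `x, g` underestimate the corresponding expectations, then the QVI-4
iterates are dominated by the value functions of the policies `π_k`, which in turn are
dominated by the optimal values. -/
theorem qvi4_monotone
    {S A : Type*} [Fintype S] [Fintype A] [Nonempty S] [Nonempty A]
    (H : ℕ) (hH : 0 < H)
    (P : ℕ → S → A → S → ℝ) (r : ℕ → S → A → ℝ)
    (hP : ∀ h < H, ∀ (s : S) (a : A), (∀ s' : S, 0 ≤ P h s a s') ∧ ∑ s' : S, P h s a s' = 1)
    (hr : ∀ h < H, ∀ (s : S) (a : A), 0 ≤ r h s a ∧ r h s a ≤ 1)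
    (ε : ℝ) (hε : 0 < ε) (hεH : ε ≤ Real.sqrt H)
    (K : ℕ) (hK : K = ⌈Real.logb 2 (H / ε)⌉₊ + 1)
    (y x g : ℕ → ℕ → S → A → ℝ)
    (V V0 : ℕ → ℕ → S → ℝ) (Vt : ℕ → ℕ → S → ℝ) (Q : ℕ → ℕ → S → A → ℝ)
    (πk π0 πt : ℕ → S → ℕ → A)
    -- QVI-4 iterate structure
    (hV00 : ∀ h ≤ H, ∀ s : S, V0 0 h s = 0)
    (hVkH : ∀ k < K, ∀ s : S, V k H s = 0)
    (hV0kH : ∀ k < K, ∀ s : S, V0 k H s = 0)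
    (hy0 : ∀ k < K, ∀ h < H, ∀ (s : S) (a : A), 0 ≤ y k h s a)
    (hQdef : ∀ k < K, ∀ h < H, ∀ (s : S) (a : A),
      Q k h s a = max (r h s a + x k h s a + g k h s a) 0)
    (hπt : ∀ k < K, ∀ h < H, ∀ (s : S) (a : A), Q k h s a ≤ Q k h s (πt k s h))
    (hVt : ∀ k < K, ∀ h < H, ∀ s : S, Vt k h s = Q k h s (πt k s h))
    (hupd₁ : ∀ k < K, ∀ h < H, ∀ s : S, V0 k h s < Vt k h s →
      V k h s = Vt k h s ∧ πk k s h = πt k s h)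
    (hupd₂ : ∀ k < K, ∀ h < H, ∀ s : S, Vt k h s ≤ V0 k h s →
      V k h s = V0 k h s ∧ πk k s h = π0 k s h)
    (hnext : ∀ k, k + 1 < K → ∀ h < H, ∀ s : S,
      V0 (k + 1) h s = V k h s ∧ π0 (k + 1) s h = πk k s h)
    -- one-sided estimate guarantees
    (hx : ∀ k < K, ∀ h < H, ∀ (s : S) (a : A),
      x k h s a ≤ ∑ s' : S, P h s a s' * V0 k (h + 1) s')
    (hg : ∀ k < K, ∀ h < H, ∀ (s : S) (a : A),
      g k h s a ≤ ∑ s' : S, P h s a s' * (V k (h + 1) s' - V0 k (h + 1) s')) :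
    ∀ k < K, ∀ h < H,
      (∀ s : S, V k h s ≤ Vpi H P r (πk k) h s ∧ Vpi H P r (πk k) h s ≤ Vstar H P r h s) ∧
      (∀ (s : S) (a : A),
        Q k h s a ≤ Qpi H P r (πk k) h s a ∧ Qpi H P r (πk k) h s a ≤ Qstar H P r h s a) := by
  have mono : ∀ h < H, ∀ (s : S) (a : A) (u v : S → ℝ), (∀ s', u s' ≤ v s') →
      ∑ s' : S, P h s a s' * u s' ≤ ∑ s' : S, P h s a s' * v s' := by
    intro h hh s a u v huv
    exact Finset.sum_le_sum fun s' _ => mul_le_mul_of_nonneg_left (huv s') ((hP h hh s a).1 s')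
  have hVV0 : ∀ k < K, ∀ h ≤ H, ∀ s, V0 k h s ≤ V k h s := by
    intro k hk h hh s
    rcases hh.lt_or_eq with hlt | rfl
    · rcases lt_or_ge (V0 k h s) (Vt k h s) with hc | hc
      · rw [(hupd₁ k hk h hlt s hc).1]; exact hc.le
      · rw [(hupd₂ k hk h hlt s hc).1]
    · rw [hVkH k hk, hV0kH k hk]
  have hV0nn : ∀ k < K, ∀ h ≤ H, ∀ s, 0 ≤ V0 k h s := by
    intro k
    induction k with
    | zero => intro _ h hh s; rw [hV00 h hh s]
    | succ k ih =>
      intro hk h hh s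
      rcases hh.lt_or_eq with hlt | rfl
      · rw [(hnext k hk h hlt s).1]
        exact (ih (by omega) h hh s).trans (hVV0 k (by omega) h hh s)
      · rw [hV0kH _ hk]
  have hVnn : ∀ k < K, ∀ h ≤ H, ∀ s, 0 ≤ V k h s := fun k hk h hh s =>
    (hV0nn k hk h hh s).trans (hVV0 k hk h hh s)
  have hPVnn : ∀ k < K, ∀ h < H, ∀ (s : S) (a : A),
      0 ≤ r h s a + ∑ s' : S, P h s a s' * V k (h + 1) s' := by
    intro k hk h hh s a
    exact add_nonneg (hr h hh s a).1 (Finset.sum_nonneg fun s' _ =>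
      mul_nonneg ((hP h hh s a).1 s') (hVnn k hk (h + 1) hh s'))
  have hQ : ∀ k < K, ∀ h < H, ∀ (s : S) (a : A),
      Q k h s a ≤ r h s a + ∑ s' : S, P h s a s' * V k (h + 1) s' := by
    intro k hk h hh s a
    rw [hQdef k hk h hh]
    refine max_le ?_ (hPVnn k hk h hh s a)
    have h1 := hx k hk h hh s a
    have h2 := hg k hk h hh s a
    simp only [mul_sub, Finset.sum_sub_distrib] at h2
    linarith
  have hB : ∀ k < K, ∀ h < H, ∀ s : S,
      V k h s ≤ r h s (πk k s h) + ∑ s' : S, P h s (πk k s h) s' * V k (h + 1) s' := by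
    intro k
    induction k with
    | zero =>
      intro hk h hh s
      rcases lt_or_ge (V0 0 h s) (Vt 0 h s) with hc | hc
      · obtain ⟨e1, e2⟩ := hupd₁ 0 hk h hh s hc
        rw [e1, e2, hVt 0 hk h hh]
        exact hQ 0 hk h hh s _
      · rw [(hupd₂ 0 hk h hh s hc).1, hV00 h hh.le]
        exact hPVnn 0 hk h hh s _
    | succ k ih =>
      intro hk h hh s
      rcases lt_or_ge (V0 (k + 1) h s) (Vt (k + 1) h s) with hc | hc
      · obtain ⟨e1, e2⟩ := hupd₁ _ hk h hh s hc
        rw [e1, e2, hVt _ hk h hh]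
        exact hQ _ hk h hh s _
      · obtain ⟨e1, e2⟩ := hupd₂ _ hk h hh s hc
        obtain ⟨e3, e4⟩ := hnext k hk h hh s
        rw [e1, e2, e3, e4]
        refine (ih (by omega) h hh s).trans ?_
        have hm := mono h hh s (πk k s h) (V k (h + 1)) (V (k + 1) (h + 1)) (by
          intro s'
          rcases (Nat.succ_le_of_lt hh).lt_or_eq with hlt | he
          · rw [← (hnext k hk (h + 1) hlt s').1]
            exact hVV0 _ hk _ hh s'
          · have he' : h + 1 = H := he
            rw [he', hVkH k (by omega), hVkH _ hk])
        linarith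
  have hC : ∀ k < K, ∀ (n h : ℕ), h + n = H → ∀ s, V k h s ≤ Vpi H P r (πk k) h s := by
    intro k hk n
    induction n with
    | zero =>
      intro h hh s
      have he : h = H := by omega
      rw [Vpi, dif_neg (by omega), he, hVkH k hk]
    | succ n ih =>
      intro h hh s
      have hlt : h < H := by omega
      rw [Vpi, dif_pos hlt]
      have h1 := hB k hk h hlt s
      have h2 := mono h hlt s (πk k s h) _ _ (ih (h + 1) (by omega))
      linarith
  intro k hk h hh
  refine ⟨fun s => ⟨hC k hk (H - h) h (by omega) s, ?_⟩, fun s a => ⟨?_, ?_⟩⟩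
  · refine le_ciSup (f := fun π => Vpi H P r π h s) ⟨((H - h : ℕ) : ℝ), ?_⟩ (πk k)
    rintro _ ⟨π, rfl⟩
    exact Vpi_bdd_aux H P r hP hr π (H - h) h (by omega) s
  · have h2 := mono h hh s a _ _ (hC k hk (H - (h + 1)) (h + 1) (by omega))
    have h1 := hQ k hk h hh s a
    unfold Qpi
    linarith
  · refine le_ciSup (f := fun π => Qpi H P r π h s a)
      ⟨r h s a + ∑ s' : S, P h s a s' * ((H - (h + 1) : ℕ) : ℝ), ?_⟩ (πk k)
    rintro _ ⟨π, rfl⟩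
    have h2 := mono h hh s a _ (fun _ => ((H - (h + 1) : ℕ) : ℝ))
      (Vpi_bdd_aux H P r hP hr π (H - (h + 1)) (h + 1) (by omega))
    show Qpi H P r π h s a ≤ _
    unfold Qpi
    linarith
end

section
/- Gap between QVI-4 iterates and the optimum: Suppose the QVI-4 iterates are formed with, for all k ∈ {0,…,K−1}, h ∈ {0,…,H−1} and (s,a) ∈ S×A: y_{k,h}(s,a) = max{Ê₂ − Ê₁², 0} for some reals Ê₁, Ê₂ with |Ê₁ − (P_h V^{(0)}_{k,h+1})(s,a)| ≤ b/H and |Ê₂ − (P_h (V^{(0)}_{k,h+1})²)(s,a)| ≤ b; |x_{k,h}(s,a) + (cε/H^{1.5})·√(y_{k,h}(s,a)+4b) − (P_h V^{(0)}_{k,h+1})(s,a)| ≤ (cε/H^{1.5})·√(y_{k,h}(s,a)+4b); and |g_{k,h}(s,a) + c·ε_k/H − (P_h (V_{k,h+1} − V^{(0)}_{k,h+1}))(s,a)| ≤ c·ε_k/H. Then for all k ∈ {0,…,K−1} and h ∈ {0,…,H−1}: V_h^* − ε_k ≤ V_{k,h} and Q_h^* − ε_k ≤ Q_{k,h} (componentwise).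 -/
open Finset

variable {S A : Type*}

/-- Optimal value by Bellman recursion. -/
noncomputable def Uopt [Fintype S] (H : ℕ) (P : ℕ → S → A → S → ℝ)
    (r : ℕ → S → A → ℝ) (h : ℕ) (s : S) : ℝ :=
  if _hlt : h < H then
    ⨆ a : A, (r h s a + ∑ s' : S, P h s a s' * Uopt H P r (h + 1) s')
  else 0
termination_by H - h
decreasing_by omega

theorem Uopt_top [Fintype S] (H : ℕ) (P : ℕ → S → A → S → ℝ)
    (r : ℕ → S → A → ℝ) (s : S) : Uopt H P r H s = 0 := by
  rw [Uopt]; simp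

theorem Uopt_ge [Fintype S] [Fintype A] (H : ℕ) (P : ℕ → S → A → S → ℝ)
    (r : ℕ → S → A → ℝ) (h : ℕ) (hh : h < H) (s : S) (a : A) :
    r h s a + ∑ s' : S, P h s a s' * Uopt H P r (h + 1) s' ≤ Uopt H P r h s := by
  conv_rhs => rw [Uopt]
  rw [dif_pos hh]
  exact le_ciSup (f := fun a => r h s a + ∑ s' : S, P h s a s' * Uopt H P r (h + 1) s')
    (Set.finite_range _).bddAbove a

theorem Uopt_ex [Fintype S] [Fintype A] [Nonempty A] (H : ℕ) (P : ℕ → S → A → S → ℝ)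
    (r : ℕ → S → A → ℝ) (h : ℕ) (hh : h < H) (s : S) :
    ∃ a, Uopt H P r h s = r h s a + ∑ s' : S, P h s a s' * Uopt H P r (h + 1) s' := by
  obtain ⟨a, ha⟩ := exists_eq_ciSup_of_finite
    (f := fun a => r h s a + ∑ s' : S, P h s a s' * Uopt H P r (h + 1) s')
  refine ⟨a, ?_⟩
  conv_lhs => rw [Uopt]
  rw [dif_pos hh]
  exact ha.symm

theorem back_ind {H : ℕ} {p : ℕ → Prop} (h0 : p H) (hs : ∀ h < H, p (h + 1) → p h) :
    ∀ h ≤ H, p h := by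
  have : ∀ n h, h + n = H → p h := by
    intro n
    induction n with
    | zero => intro h e; simp at e; subst e; exact h0
    | succ n ih => intro h e; exact hs h (by omega) (ih (h + 1) (by omega))
  intro h hh
  exact this (H - h) h (by omega)

theorem avg_mono [Fintype S] {p f g : S → ℝ} (hp : ∀ s, 0 ≤ p s) (h : ∀ s, f s ≤ g s) :
    ∑ s, p s * f s ≤ ∑ s, p s * g s :=
  Finset.sum_le_sum fun s _ => mul_le_mul_of_nonneg_left (h s) (hp s)

theorem avg_const [Fintype S] {p : S → ℝ} (h1 : ∑ s, p s = 1) (c : ℝ) :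
    ∑ s, p s * c = c := by
  rw [← Finset.sum_mul, h1, one_mul]

theorem avg_sq [Fintype S] {p f : S → ℝ} (hp : ∀ s, 0 ≤ p s) (h1 : ∑ s, p s = 1) :
    (∑ s, p s * f s) ^ 2 ≤ ∑ s, p s * f s ^ 2 := by
  set m := ∑ s, p s * f s with hm
  have h0 : 0 ≤ ∑ s, p s * (f s - m) ^ 2 :=
    Finset.sum_nonneg fun s _ => mul_nonneg (hp s) (sq_nonneg _)
  have : ∑ s, p s * (f s - m) ^ 2 = ∑ s, p s * f s ^ 2 - 2 * m * ∑ s, p s * f s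
      + m ^ 2 * ∑ s, p s := by
    clear_value m
    rw [Finset.mul_sum, Finset.mul_sum, ← Finset.sum_sub_distrib, ← Finset.sum_add_distrib]
    exact Finset.sum_congr rfl fun s _ => by ring
  rw [this, h1, ← hm] at h0
  nlinarith

theorem var_bound [Fintype S] {p u v : S → ℝ} (hp : ∀ s, 0 ≤ p s) (h1 : ∑ s, p s = 1)
    {E : ℝ} (hvu : ∀ s, v s ≤ u s) (huv : ∀ s, u s - v s ≤ E) :
    ∑ s, p s * v s ^ 2 - (∑ s, p s * v s) ^ 2 ≤
      2 * (∑ s, p s * u s ^ 2 - (∑ s, p s * u s) ^ 2) + 2 * E ^ 2 := by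
  have hw : ∑ s, p s * (u s - v s) ^ 2 ≤ E ^ 2 := by
    rw [← avg_const h1 (E ^ 2)]
    exact avg_mono hp fun s => pow_le_pow_left₀ (sub_nonneg.2 (hvu s)) (huv s) 2
  have hs := avg_sq (f := fun s => 2 * u s - v s) hp h1
  have e1 : ∑ s, p s * (2 * u s - v s) = 2 * ∑ s, p s * u s - ∑ s, p s * v s := by
    rw [Finset.mul_sum, ← Finset.sum_sub_distrib]
    exact Finset.sum_congr rfl fun s _ => by ring
  have e2 : ∑ s, p s * (2 * u s - v s) ^ 2 =
      2 * ∑ s, p s * u s ^ 2 + 2 * ∑ s, p s * (u s - v s) ^ 2 - ∑ s, p s * v s ^ 2 := by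
    rw [Finset.mul_sum, Finset.mul_sum, ← Finset.sum_add_distrib, ← Finset.sum_sub_distrib]
    exact Finset.sum_congr rfl fun s _ => by ring
  simp only [e1, e2] at hs
  nlinarith [sq_nonneg (∑ s, p s * u s - ∑ s, p s * v s)]

theorem y_bound {N m M E₁ E₂ : ℝ} (hN : 1 ≤ N) (hm0 : 0 ≤ m) (hmN : m ≤ N) (hM : m ^ 2 ≤ M)
    (h1 : |E₁ - m| ≤ 1 / N) (h2 : |E₂ - M| ≤ 1) : max (E₂ - E₁ ^ 2) 0 ≤ M - m ^ 2 + 3 := by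
  have hN0 : 0 < N := by linarith
  rw [abs_le] at h1 h2
  have h3 : m * (1 / N) ≤ 1 := by
    rw [mul_one_div, div_le_one hN0]; exact hmN
  apply max_le
  · nlinarith [sq_nonneg (E₁ - m), mul_le_mul_of_nonneg_left h1.1 hm0]
  · linarith

theorem sqrt_bound {z q E W : ℝ} (hq : 1 ≤ q) (hE : 0 ≤ E) (hW : 0 ≤ W) (hz0 : 0 ≤ z)
    (hz : z ≤ 2 * W + 2 * E ^ 2 + 7) :
    Real.sqrt z ≤ W / q + (q / 2 + 3 / 2 * E + 7 / 2 / q) := by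
  have hq0 : 0 < q := by linarith
  have hl : 0 < q + E := by linarith
  have h1 : Real.sqrt z ≤ z / (2 * (q + E)) + (q + E) / 2 := by
    rw [div_add_div _ _ (by positivity) (by norm_num), le_div_iff₀ (by positivity)]
    nlinarith [Real.sq_sqrt hz0, sq_nonneg (Real.sqrt z - (q + E))]
  have h2 : z / (2 * (q + E)) ≤ W / (q + E) + E ^ 2 / (q + E) + 7 / 2 / (q + E) := by
    rw [← add_div, ← add_div, div_le_div_iff₀ (by positivity) hl]
    nlinarith
  have h3 : W / (q + E) ≤ W / q := div_le_div_of_nonneg_left hW hq0 (by linarith)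
  have h4 : 7 / 2 / (q + E) ≤ 7 / 2 / q :=
    div_le_div_of_nonneg_left (by norm_num) hq0 (by linarith)
  have h5 : E ^ 2 / (q + E) ≤ E := by
    rw [div_le_iff₀ hl]; nlinarith
  linarith

theorem final_num {q e ε : ℝ} (hq : 1 ≤ q) (he : 0 < e) (hε : 0 < ε) (h1 : ε ≤ 2 * e)
    (h2 : ε ≤ q) :
    2 * (0.001 * ε / q ^ 3) / q * (q ^ 2) ^ 2 + q ^ 2 * (2 * (0.001 * e / q ^ 2) +
      2 * (0.001 * ε / q ^ 3) * (q / 2 + 3 / 2 * (2 * e) + 7 / 2 / q)) ≤ e := by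
  have hq0 : 0 < q := by linarith
  have : 2 * (0.001 * ε / q ^ 3) / q * (q ^ 2) ^ 2 + q ^ 2 * (2 * (0.001 * e / q ^ 2) +
      2 * (0.001 * ε / q ^ 3) * (q / 2 + 3 / 2 * (2 * e) + 7 / 2 / q)) =
      0.002 * (ε + e + ε / 2 + 3 * e * (ε / q) + 3.5 * (ε / q ^ 2)) := by
    field_simp; ring
  rw [this]
  have h3 : ε / q ≤ 1 := (div_le_one hq0).2 h2
  have h4 : ε / q ^ 2 ≤ ε := div_le_self hε.le (by nlinarith)
  nlinarith

theorem eps_le (H : ℕ) (hH : 0 < H) (ε : ℝ) (hε : 0 < ε) (hεH : ε ≤ Real.sqrt H)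
    (k : ℕ) (hk : k < ⌈Real.logb 2 (H / ε)⌉₊ + 1) : ε ≤ 2 * ((H : ℝ) / 2 ^ k) := by
  have hN : (1 : ℝ) ≤ H := by exact_mod_cast hH
  have hεN : ε ≤ H := hεH.trans (Real.sqrt_le_iff.2 ⟨by linarith, by nlinarith⟩)
  have hl : 0 ≤ Real.logb 2 (H / ε) :=
    Real.logb_nonneg (by norm_num) ((one_le_div hε).2 hεN)
  have h1 : (k : ℝ) ≤ Real.logb 2 (H / ε) + 1 := by
    have := Nat.ceil_lt_add_one hl
    have h2 : (k : ℝ) ≤ ⌈Real.logb 2 (H / ε)⌉₊ := by exact_mod_cast Nat.lt_succ_iff.1 hk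
    linarith
  have h3 : (2 : ℝ) ^ k ≤ 2 * (H / ε) := by
    rw [← Real.rpow_natCast]
    refine (Real.rpow_le_rpow_of_exponent_le (by norm_num) h1).trans ?_
    rw [Real.rpow_add (by norm_num), Real.rpow_logb (by norm_num) (by norm_num) (by positivity)]
    simp [mul_comm]
  have h4 : (0 : ℝ) < 2 ^ k := by positivity
  rw [← mul_div_assoc, le_div_iff₀ h4]
  calc ε * 2 ^ k ≤ ε * (2 * (H / ε)) := by gcongr
    _ = 2 * H := by field_simp

theorem pow_q (H : ℕ) : (H : ℝ) ^ (1.5 : ℝ) = Real.sqrt H ^ 3 := by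
  rw [Real.sqrt_eq_rpow, ← Real.rpow_natCast, ← Real.rpow_mul (by positivity)]
  norm_num

/-- **Gap between QVI-4 iterates and the optimum.**
If all mean estimates meet their error guarantees, then for every epoch `k` and time
step `h`, the QVI-4 iterates are within `ε_k = H/2^k` of the optimal values. -/
theorem qvi4_gap
{S A : Type*} [Fintype S] [Fintype A] [Nonempty S] [Nonempty A]
    (H : ℕ) (hH : 0 < H)
    (P : ℕ → S → A → S → ℝ) (r : ℕ → S → A → ℝ)
    (hP : ∀ h < H, ∀ (s : S) (a : A), (∀ s' : S, 0 ≤ P h s a s') ∧ ∑ s' : S, P h s a s' = 1)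
    (hr : ∀ h < H, ∀ (s : S) (a : A), 0 ≤ r h s a ∧ r h s a ≤ 1)
    (ε : ℝ) (hε : 0 < ε) (hεH : ε ≤ Real.sqrt H)
    (K : ℕ) (hK : K = ⌈Real.logb 2 (H / ε)⌉₊ + 1)
    (y x g : ℕ → ℕ → S → A → ℝ)
    (V V0 : ℕ → ℕ → S → ℝ) (Vt : ℕ → ℕ → S → ℝ) (Q : ℕ → ℕ → S → A → ℝ)
    (πk π0 πt : ℕ → S → ℕ → A)
    -- QVI-4 iterate structure
    (hV00 : ∀ h ≤ H, ∀ s : S, V0 0 h s = 0)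
    (hVkH : ∀ k < K, ∀ s : S, V k H s = 0)
    (hV0kH : ∀ k < K, ∀ s : S, V0 k H s = 0)
    (hy0 : ∀ k < K, ∀ h < H, ∀ (s : S) (a : A), 0 ≤ y k h s a)
    (hQdef : ∀ k < K, ∀ h < H, ∀ (s : S) (a : A),
      Q k h s a = max (r h s a + x k h s a + g k h s a) 0)
    (hπt : ∀ k < K, ∀ h < H, ∀ (s : S) (a : A), Q k h s a ≤ Q k h s (πt k s h))
    (hVt : ∀ k < K, ∀ h < H, ∀ s : S, Vt k h s = Q k h s (πt k s h))
    (hupd₁ : ∀ k < K, ∀ h < H, ∀ s : S, V0 k h s < Vt k h s →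
      V k h s = Vt k h s ∧ πk k s h = πt k s h)
    (hupd₂ : ∀ k < K, ∀ h < H, ∀ s : S, Vt k h s ≤ V0 k h s →
      V k h s = V0 k h s ∧ πk k s h = π0 k s h)
    (hnext : ∀ k, k + 1 < K → ∀ h < H, ∀ s : S,
      V0 (k + 1) h s = V k h s ∧ π0 (k + 1) s h = πk k s h)
    -- estimate guarantees (with b = 1 and c = 0.001)
    (hy : ∀ k < K, ∀ h < H, ∀ (s : S) (a : A), ∃ E₁ E₂ : ℝ,
      |E₁ - ∑ s' : S, P h s a s' * V0 k (h + 1) s'| ≤ 1 / H ∧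
      |E₂ - ∑ s' : S, P h s a s' * (V0 k (h + 1) s') ^ 2| ≤ 1 ∧
      y k h s a = max (E₂ - E₁ ^ 2) 0)
    (hx : ∀ k < K, ∀ h < H, ∀ (s : S) (a : A),
      |x k h s a + (0.001 * ε / (H : ℝ) ^ (1.5 : ℝ)) * Real.sqrt (y k h s a + 4 * 1)
          - ∑ s' : S, P h s a s' * V0 k (h + 1) s'|
        ≤ (0.001 * ε / (H : ℝ) ^ (1.5 : ℝ)) * Real.sqrt (y k h s a + 4 * 1))
    (hg : ∀ k < K, ∀ h < H, ∀ (s : S) (a : A),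
      |g k h s a + 0.001 * ((H : ℝ) / 2 ^ k) / H
          - ∑ s' : S, P h s a s' * (V k (h + 1) s' - V0 k (h + 1) s')|
        ≤ 0.001 * ((H : ℝ) / 2 ^ k) / H) :
    ∀ k < K, ∀ h < H,
      (∀ s : S, Vstar H P r h s - (H : ℝ) / 2 ^ k ≤ V k h s) ∧
      (∀ (s : S) (a : A), Qstar H P r h s a - (H : ℝ) / 2 ^ k ≤ Q k h s a) := by
  set N : ℝ := (H : ℝ) with hNdef
  have hN : (1 : ℝ) ≤ N := by rw [hNdef]; exact_mod_cast hH
  set q := Real.sqrt N with hqdef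
  have hqq : q ^ 2 = N := Real.sq_sqrt (by linarith)
  have hq : 1 ≤ q := Real.one_le_sqrt.2 hN
  have hq0 : 0 < q := by linarith
  have hpow : N ^ (1.5 : ℝ) = q ^ 3 := pow_q H
  rw [hpow] at hx
  set U := Uopt H P r with hU
  have hUH : ∀ s, U H s = 0 := Uopt_top H P r
  have hUge := Uopt_ge H P r
  have hUex := Uopt_ex H P r
  rw [← hU] at hUge hUex
  clear_value U
  -- bounds on U
  have hUb : ∀ h ≤ H, ∀ s, 0 ≤ U h s ∧ U h s ≤ N - h := by
    refine back_ind (fun s => by rw [hUH]; simp [hNdef]) ?_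
    intro h hh ih s
    obtain ⟨a, ha⟩ := hUex h hh s
    obtain ⟨p0, p1⟩ := hP h hh s a
    have b1 := avg_mono p0 (fun s' => (ih s').1)
    have b2 := avg_mono p0 (fun s' => (ih s').2)
    rw [avg_const p1] at b1 b2
    push_cast at b2
    have := hr h hh s a
    constructor <;> linarith
  have hVpi : ∀ π : S → ℕ → A, ∀ h ≤ H, ∀ s, Vpi H P r π h s ≤ U h s := by
    intro π
    refine back_ind (fun s => by rw [hUH, Vpi]; simp) ?_
    intro h hh ih s
    rw [Vpi, dif_pos hh]
    have := avg_mono (hP h hh s (π s h)).1 ih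
    have := hUge h hh s (π s h)
    linarith
  have : Nonempty (S → ℕ → A) := inferInstance
  have hVstar : ∀ h ≤ H, ∀ s, Vstar H P r h s ≤ U h s := fun h hh s =>
    ciSup_le fun π => hVpi π h hh s
  have hQstar : ∀ h < H, ∀ s a, Qstar H P r h s a ≤ r h s a + ∑ s', P h s a s' * U (h + 1) s' := by
    intro h hh s a
    refine ciSup_le fun π => ?_
    have := avg_mono (hP h hh s a).1 (hVpi π (h + 1) hh)
    unfold Qpi
    linarith
  -- one epoch
  have epoch : ∀ k < K, (∀ h ≤ H, ∀ s, 0 ≤ V0 k h s ∧ V0 k h s ≤ U h s ∧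
        U h s - V0 k h s ≤ 2 * (N / 2 ^ k)) →
      (∀ h ≤ H, ∀ s, 0 ≤ V k h s ∧ V k h s ≤ U h s ∧ U h s - V k h s ≤ N / 2 ^ k) ∧
      (∀ h < H, ∀ s a, r h s a + ∑ s', P h s a s' * U (h + 1) s' - N / 2 ^ k ≤ Q k h s a) := by
    intro k hk inv
    have hεe : ε ≤ 2 * (N / 2 ^ k) := eps_le H hH ε hε hεH k (hK ▸ hk)
    have he0 : 0 < N / 2 ^ k := by positivity
    set e := N / 2 ^ k with he
    clear_value e
    have hsplit : ∀ h s a, ∑ s', P h s a s' * (V k (h + 1) s' - V0 k (h + 1) s') =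
        ∑ s', P h s a s' * V k (h + 1) s' - ∑ s', P h s a s' * V0 k (h + 1) s' := by
      intro h s a
      rw [← Finset.sum_sub_distrib]
      exact Finset.sum_congr rfl fun s' _ => by ring
    have hVge : ∀ h < H, ∀ s, V0 k h s ≤ V k h s ∧ Q k h s (πt k s h) ≤ V k h s := by
      intro h hh s
      rw [← hVt k hk h hh s]
      rcases lt_or_ge (V0 k h s) (Vt k h s) with hlt | hle
      · rw [(hupd₁ k hk h hh s hlt).1]; exact ⟨hlt.le, le_rfl⟩
      · rw [(hupd₂ k hk h hh s hle).1]; exact ⟨le_rfl, hle⟩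
    have hV0 : ∀ h ≤ H, ∀ s, 0 ≤ V k h s := by
      intro h hh s
      rcases hh.lt_or_eq with hlt | rfl
      · exact (inv h hh s).1.trans (hVge h hlt s).1
      · rw [hVkH k hk]
    have hVU : ∀ h ≤ H, ∀ s, V k h s ≤ U h s := by
      refine back_ind (fun s => by rw [hUH, hVkH k hk]) ?_
      intro h hh ih s
      rcases lt_or_ge (V0 k h s) (Vt k h s) with hlt | hle
      · rw [(hupd₁ k hk h hh s hlt).1, hVt k hk h hh, hQdef k hk h hh]
        set a := πt k s h
        refine max_le ?_ (hUb h hh.le s).1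
        have i1 := (abs_le.1 (hx k hk h hh s a)).2
        have i2 := (abs_le.1 (hg k hk h hh s a)).2
        rw [hsplit] at i2
        have i3 := avg_mono (hP h hh s a).1 ih
        have := hUge h hh s a
        linarith
      · rw [(hupd₂ k hk h hh s hle).1]; exact (inv h hh.le s).2.1
    set al := 2 * (0.001 * ε / q ^ 3) / q with hal
    set be := 2 * (0.001 * e / q ^ 2) +
      2 * (0.001 * ε / q ^ 3) * (q / 2 + 3 / 2 * (2 * e) + 7 / 2 / q) with hbe
    have hal0 : 0 ≤ al := by positivity
    have hbe0 : 0 ≤ be := by positivity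
    have hfin : al * N ^ 2 + N * be ≤ e := by
      rw [← hqq]; exact final_num hq he0 hε hεe hεH
    -- one-step bound
    have hone : ∀ h < H, ∀ s a, r h s a + ∑ s', P h s a s' * V k (h + 1) s' -
        al * (∑ s', P h s a s' * U (h + 1) s' ^ 2 - (∑ s', P h s a s' * U (h + 1) s') ^ 2) - be
          ≤ Q k h s a := by
      intro h hh s a
      obtain ⟨p0, p1⟩ := hP h hh s a
      have i1 := (abs_le.1 (hx k hk h hh s a)).1
      have i2 := (abs_le.1 (hg k hk h hh s a)).1
      rw [hsplit] at i2
      obtain ⟨E₁, E₂, j1, j2, j3⟩ := hy k hk h hh s a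
      have m0 := avg_mono p0 (fun s' => (inv (h + 1) hh s').1)
      have m1 := avg_mono p0 (fun s' => ((inv (h + 1) hh s').2.1.trans
        (hUb (h + 1) hh s').2))
      rw [avg_const p1] at m0 m1
      have hc : (0 : ℝ) ≤ ((h + 1 : ℕ) : ℝ) := Nat.cast_nonneg _
      have yb := y_bound hN m0 (by linarith) (avg_sq p0 p1) j1 j2
      rw [← j3] at yb
      have vb := var_bound p0 p1 (fun s' => (inv (h + 1) hh s').2.1)
        (fun s' => (inv (h + 1) hh s').2.2)
      have W0 := avg_sq (f := fun s' => U (h + 1) s') p0 p1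
      have sb := sqrt_bound (z := y k h s a + 4 * 1) (E := 2 * e)
        (W := ∑ s', P h s a s' * U (h + 1) s' ^ 2 - (∑ s', P h s a s' * U (h + 1) s') ^ 2)
        hq (by linarith) (by linarith) (by linarith [hy0 k hk h hh s a]) (by linarith)
      have hd : 0 ≤ 2 * (0.001 * ε / q ^ 3) := by positivity
      have sb2 := mul_le_mul_of_nonneg_left sb hd
      have ev : ∀ W : ℝ, 2 * (0.001 * ε / q ^ 3) * (W / q) = al * W := by
        intro W; rw [hal]; ring
      rw [mul_add, ev] at sb2
      rw [hQdef k hk h hh]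
      refine le_trans ?_ (le_max_left _ _)
      rw [← he, ← hqq] at i2
      rw [hbe]
      linarith
    -- gap for Q from the gap for V
    have hQgap : ∀ h < H, (∀ s, U (h + 1) s - V k (h + 1) s ≤
        al * ((N - (h + 1 : ℕ)) ^ 2 - U (h + 1) s ^ 2) + (N - (h + 1 : ℕ)) * be) →
        ∀ s a, r h s a + ∑ s', P h s a s' * U (h + 1) s' - Q k h s a ≤
          al * ((N - (h + 1 : ℕ)) ^ 2 - (∑ s', P h s a s' * U (h + 1) s') ^ 2)
            + (N - h) * be := by
      intro h hh ih s a
      obtain ⟨p0, p1⟩ := hP h hh s a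
      have h1 := hone h hh s a
      have h2 := avg_mono p0 ih
      have e1 : ∑ s', P h s a s' * (U (h + 1) s' - V k (h + 1) s') =
          ∑ s', P h s a s' * U (h + 1) s' - ∑ s', P h s a s' * V k (h + 1) s' := by
        rw [← Finset.sum_sub_distrib]
        exact Finset.sum_congr rfl fun s' _ => by ring
      have e2 : ∑ s', P h s a s' * (al * ((N - (h + 1 : ℕ)) ^ 2 - U (h + 1) s' ^ 2)
          + (N - (h + 1 : ℕ)) * be) =
          (al * (N - (h + 1 : ℕ)) ^ 2 + (N - (h + 1 : ℕ)) * be) * ∑ s', P h s a s'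
            - al * ∑ s', P h s a s' * U (h + 1) s' ^ 2 := by
        rw [Finset.mul_sum, Finset.mul_sum, ← Finset.sum_sub_distrib]
        exact Finset.sum_congr rfl fun s' _ => by ring
      rw [e1, e2, p1] at h2
      push_cast at h2 ⊢
      linarith
    have hVgap : ∀ h ≤ H, ∀ s, U h s - V k h s ≤
        al * ((N - (h : ℕ)) ^ 2 - U h s ^ 2) + (N - (h : ℕ)) * be := by
      refine back_ind (fun s => by rw [hUH, hVkH k hk]; simp [hNdef]) ?_
      intro h hh ih s
      obtain ⟨a, ha⟩ := hUex h hh s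
      have h1 := hQgap h hh ih s a
      have h2 := (hπt k hk h hh s a).trans (hVge h hh s).2
      obtain ⟨p0, p1⟩ := hP h hh s a
      have b1 := avg_mono p0 (fun s' => (hUb (h + 1) hh s').1)
      have b2 := avg_mono p0 (fun s' => (hUb (h + 1) hh s').2)
      rw [avg_const p1] at b1 b2
      obtain ⟨r0, r1⟩ := hr h hh s a
      rw [← ha] at h1
      have h3 : (N - (h + 1 : ℕ)) ^ 2 - (∑ s', P h s a s' * U (h + 1) s') ^ 2 ≤
          (N - (h : ℕ)) ^ 2 - U h s ^ 2 := by
        rw [ha]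
        push_cast at b2 ⊢
        nlinarith
      have h4 := mul_le_mul_of_nonneg_left h3 hal0
      linarith
    have hcl : ∀ (h : ℕ), h ≤ H → ∀ (j : ℕ), j ≤ H → ∀ z : ℝ,
        al * ((N - (j : ℕ)) ^ 2 - z ^ 2) + (N - (h : ℕ)) * be ≤ e := by
      intro h hh j hj z
      have c1 : (0 : ℝ) ≤ (h : ℝ) := Nat.cast_nonneg _
      have c2 : (0 : ℝ) ≤ (j : ℝ) := Nat.cast_nonneg _
      have c3 : (j : ℝ) ≤ N := by rw [hNdef]; exact_mod_cast hj
      have c4 : (N - (j : ℕ)) ^ 2 - z ^ 2 ≤ N ^ 2 := by nlinarith [sq_nonneg z]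
      have c5 := mul_le_mul_of_nonneg_left c4 hal0
      have c6 := mul_nonneg c1 hbe0
      linarith
    refine ⟨fun h hh s => ⟨hV0 h hh s, hVU h hh s, (hVgap h hh s).trans (hcl h hh h hh _)⟩, ?_⟩
    intro h hh s a
    have := (hQgap h hh (hVgap (h + 1) hh) s a).trans (hcl h hh.le (h + 1) hh _)
    linarith
  have inv : ∀ k < K, ∀ h ≤ H, ∀ s, 0 ≤ V0 k h s ∧ V0 k h s ≤ U h s ∧
        U h s - V0 k h s ≤ 2 * (N / 2 ^ k) := by
    intro k
    induction k with
    | zero =>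
      intro _ h hh s
      have := hUb h hh s
      have hc : (0 : ℝ) ≤ (h : ℝ) := Nat.cast_nonneg _
      rw [hV00 h hh]
      refine ⟨le_rfl, this.1, ?_⟩
      simp only [pow_zero, div_one]
      linarith
    | succ k ih =>
      intro hk h hh s
      have hk' : k < K := by omega
      have := (epoch k hk' (ih hk')).1 h hh s
      have e0 : V0 (k + 1) h s = V k h s := by
        rcases hh.lt_or_eq with hlt | rfl
        · exact (hnext k hk h hlt s).1
        · rw [hV0kH _ hk, hVkH k hk']
      rw [e0]
      refine ⟨this.1, this.2.1, this.2.2.trans (le_of_eq ?_)⟩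
      rw [pow_succ]; field_simp
  intro k hk h hh
  obtain ⟨e1, e2⟩ := epoch k hk (inv k hk)
  constructor
  · intro s
    have := (e1 h hh.le s).2.2
    have := hVstar h hh.le s
    linarith
  · intro s a
    have := e2 h hh s a
    have := hQstar h hh s a
    linarith
end

section
/- Correctness of QVI-4 (deterministic core, assuming all mean estimates meet their error guarantees): Under the QVI-4 iterates with, for all k, h, (s,a): y_{k,h}(s,a) = max{Ê₂ − Ê₁², 0} for some reals Ê₁, Ê₂ with |Ê₁ − (P_h V^{(0)}_{k,h+1})(s,a)| ≤ b/H and |Ê₂ − (P_h (V^{(0)}_{k,h+1})²)(s,a)| ≤ b; |x_{k,h}(s,a) + (cε/H^{1.5})·√(y_{k,h}(s,a)+4b) − (P_h V^{(0)}_{k,h+1})(s,a)| ≤ (cε/H^{1.5})·√(y_{k,h}(s,a)+4b); and |g_{k,h}(s,a) + c·ε_k/H − (P_h (V_{k,h+1} − V^{(0)}_{k,h+1}))(s,a)| ≤ c·ε_k/H, the outputs π̂ := π_{K−1}, V̂_h := V_{K−1,h}, Q̂_h := Q_{K−1,h} satisfy, for every h ∈ {0,…,H−1}: V_h^* − ε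 ≤ V̂_h ≤ V_h^{π̂} ≤ V_h^* and Q_h^* − ε ≤ Q̂_h ≤ Q_h^{π̂} ≤ Q_h^* (componentwise). -/
open Finset

variable {S A : Type*}

lemma aux_mono {S : Type*} [Fintype S] {p f g : S → ℝ} (hp : ∀ s, 0 ≤ p s)
    (hfg : ∀ s, f s ≤ g s) : ∑ s, p s * f s ≤ ∑ s, p s * g s :=
  Finset.sum_le_sum fun s _ => mul_le_mul_of_nonneg_left (hfg s) (hp s)

lemma aux_le {S : Type*} [Fintype S] {p f : S → ℝ} (hp : ∀ s, 0 ≤ p s) (h1 : ∑ s, p s = 1)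
    {c : ℝ} (hf : ∀ s, f s ≤ c) : ∑ s, p s * f s ≤ c := by
  have := aux_mono (g := fun _ => c) hp hf
  rwa [← Finset.sum_mul, h1, one_mul] at this

lemma aux_nonneg {S : Type*} [Fintype S] {p f : S → ℝ} (hp : ∀ s, 0 ≤ p s)
    (hf : ∀ s, 0 ≤ f s) : 0 ≤ ∑ s, p s * f s :=
  Finset.sum_nonneg fun s _ => mul_nonneg (hp s) (hf s)

lemma aux_var {S : Type*} [Fintype S] {p f : S → ℝ} (hp : ∀ s, 0 ≤ p s) (h1 : ∑ s, p s = 1) :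
    (∑ s, p s * f s) ^ 2 ≤ ∑ s, p s * f s ^ 2 := by
  obtain ⟨m, hm⟩ : ∃ m, m = ∑ s, p s * f s := ⟨_, rfl⟩
  rw [← hm]
  have h : 0 ≤ ∑ s, p s * (f s - m) ^ 2 := aux_nonneg hp fun s => sq_nonneg _
  have e : ∑ s, p s * (f s - m) ^ 2 = ∑ s, p s * f s ^ 2 - 2 * m * m + m ^ 2 * 1 := by
    have e2 : 2 * m * m = ∑ s, 2 * m * (p s * f s) := by rw [← Finset.mul_sum, ← hm]
    rw [← h1, e2, Finset.mul_sum, ← Finset.sum_sub_distrib, ← Finset.sum_add_distrib]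
    exact Finset.sum_congr rfl fun s _ => by ring
  nlinarith

lemma aux_sqrt {S : Type*} [Fintype S] {p W U : S → ℝ} (hp : ∀ s, 0 ≤ p s) (h1 : ∑ s, p s = 1)
    {B e q E₁ E₂ : ℝ} (hB : 1 ≤ B) (he : 0 ≤ e) (hq : 0 < q)
    (hU0 : ∀ s, 0 ≤ U s) (hUW : ∀ s, U s ≤ W s) (hWB : ∀ s, W s ≤ B)
    (hWe : ∀ s, W s - U s ≤ 2 * e)
    (hE1 : |E₁ - ∑ s, p s * U s| ≤ 1 / B) (hE2 : |E₂ - ∑ s, p s * U s ^ 2| ≤ 1) :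
    Real.sqrt (max (E₂ - E₁ ^ 2) 0 + 4 * 1) ≤
      (∑ s, p s * W s ^ 2 - (∑ s, p s * W s) ^ 2) / q + q / 2 + 3 * e + 3 := by
  have hv := aux_var (f := W) hp h1
  have hv2 := aux_var (f := fun s => 2 * W s - U s) hp h1
  have hd : ∑ s, p s * (W s - U s) ^ 2 ≤ 4 * e ^ 2 := aux_le hp h1 fun s => by
    have := hUW s
    have := hWe s
    nlinarith
  have hm0 : 0 ≤ ∑ s, p s * U s := aux_nonneg hp hU0
  have hmB : ∑ s, p s * U s ≤ B := aux_le hp h1 fun s => (hUW s).trans (hWB s)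
  have e1 : ∑ s, p s * (2 * W s - U s) = 2 * ∑ s, p s * W s - ∑ s, p s * U s := by
    rw [Finset.mul_sum, ← Finset.sum_sub_distrib]
    exact Finset.sum_congr rfl fun s _ => by ring
  have e2 : ∑ s, p s * (2 * W s - U s) ^ 2 =
      2 * ∑ s, p s * W s ^ 2 + 2 * ∑ s, p s * (W s - U s) ^ 2 - ∑ s, p s * U s ^ 2 := by
    rw [Finset.mul_sum, Finset.mul_sum, ← Finset.sum_add_distrib, ← Finset.sum_sub_distrib]
    exact Finset.sum_congr rfl fun s _ => by ring
  rw [e1, e2] at hv2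
  generalize (∑ s, p s * W s ^ 2) = w2 at *
  generalize (∑ s, p s * W s) = n at *
  generalize (∑ s, p s * U s ^ 2) = u2 at *
  generalize (∑ s, p s * U s) = m at *
  generalize (∑ s, p s * (W s - U s) ^ 2) = d at *
  have hBp : 0 < B := by linarith
  have hs : u2 - m ^ 2 ≤ 2 * (w2 - n ^ 2) + 8 * e ^ 2 := by nlinarith [sq_nonneg (n - m)]
  have hE1' : m - 1 / B ≤ E₁ := by linarith [(abs_le.1 hE1).1]
  have hE2' : E₂ ≤ u2 + 1 := by linarith [(abs_le.1 hE2).2]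
  have hmb : m * (1 / B) ≤ 1 := by
    rw [mul_one_div, div_le_one hBp]; exact hmB
  have hE1s : m ^ 2 - 2 ≤ E₁ ^ 2 := by nlinarith [sq_nonneg (E₁ - m)]
  have hy : max (E₂ - E₁ ^ 2) 0 ≤ 2 * (w2 - n ^ 2) + 8 * e ^ 2 + 3 := by
    apply max_le
    · linarith
    · nlinarith [sq_nonneg e]
  set v := w2 - n ^ 2 with hvdef
  have hv0 : 0 ≤ v := by linarith
  have ha : 0 ≤ v / q := div_nonneg hv0 hq.le
  have hvq : v = (v / q) * q := by field_simp
  apply Real.sqrt_le_iff.2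
  constructor
  · positivity
  · generalize v / q = t at *
    nlinarith [sq_nonneg (t - q / 2), mul_nonneg ha he, mul_nonneg hq.le he]

section mdp
variable {S A : Type*} [Fintype S] (H : ℕ) (P : ℕ → S → A → S → ℝ) (r : ℕ → S → A → ℝ)

lemma aux_Vpi_lt (π : S → ℕ → A) {h : ℕ} (hh : h < H) (s : S) :
    Vpi H P r π h s = r h s (π s h) + ∑ s' : S, P h s (π s h) s' * Vpi H P r π (h + 1) s' := by
  rw [Vpi, dif_pos hh]

lemma aux_Vpi_top (π : S → ℕ → A) (s : S) : Vpi H P r π H s = 0 := by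
  rw [Vpi, dif_neg (lt_irrefl _)]

lemma aux_Vpi_bd
    (hP : ∀ h < H, ∀ (s : S) (a : A), (∀ s' : S, 0 ≤ P h s a s') ∧ ∑ s' : S, P h s a s' = 1)
    (hr : ∀ h < H, ∀ (s : S) (a : A), 0 ≤ r h s a ∧ r h s a ≤ 1) (π : S → ℕ → A) :
    ∀ n h : ℕ, h + n = H → ∀ s, 0 ≤ Vpi H P r π h s ∧ Vpi H P r π h s ≤ n := by
  intro n
  induction n with
  | zero =>
    intro h hh s
    obtain rfl : h = H := by omega
    simp [aux_Vpi_top]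
  | succ n ih =>
    intro h hh s
    have hlt : h < H := by omega
    have ih' := ih (h + 1) (by omega)
    rw [aux_Vpi_lt H P r π hlt]
    have p := hP h hlt s (π s h)
    have q := hr h hlt s (π s h)
    have a1 := aux_nonneg p.1 (fun s' => (ih' s').1)
    have a2 := aux_le p.1 p.2 (fun s' => (ih' s').2)
    push_cast
    constructor <;> linarith

lemma aux_opt [Finite A] [Nonempty A]
    (hP : ∀ h < H, ∀ (s : S) (a : A), (∀ s' : S, 0 ≤ P h s a s') ∧ ∑ s' : S, P h s a s' = 1) :
    ∃ πs : S → ℕ → A, ∀ n h : ℕ, h + n = H → ∀ s π, Vpi H P r π h s ≤ Vpi H P r πs h s := by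
  let U : ℕ → S → ℝ := fun n => Nat.rec (fun _ => 0)
    (fun n u s => ⨆ a : A, (r (H - (n + 1)) s a + ∑ s', P (H - (n + 1)) s a s' * u s')) n
  have hU0 : ∀ s, U 0 s = 0 := fun _ => rfl
  have hU : ∀ n s, U (n + 1) s =
    ⨆ a : A, (r (H - (n + 1)) s a + ∑ s', P (H - (n + 1)) s a s' * U n s') := fun _ _ => rfl
  clear_value U
  have hex : ∀ s h, ∃ a : A, ∀ b : A, r h s b + ∑ s', P h s b s' * U (H - (h + 1)) s' ≤
      r h s a + ∑ s', P h s a s' * U (H - (h + 1)) s' := fun s h =>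
    Finite.exists_max (fun b : A => r h s b + ∑ s', P h s b s' * U (H - (h + 1)) s')
  choose πs hπs using hex
  have hUs : ∀ n h : ℕ, h + (n + 1) = H → ∀ s,
      U (n + 1) s = r h s (πs s h) + ∑ s', P h s (πs s h) s' * U n s' := by
    intro n h hh s
    have e1 : H - (n + 1) = h := by omega
    have e2 : H - (h + 1) = n := by omega
    have := hπs s h
    rw [e2] at this
    rw [hU, e1]
    apply le_antisymm
    · exact ciSup_le this
    · exact le_ciSup (f := fun a : A => r h s a + ∑ s', P h s a s' * U n s')
        (Set.finite_range _).bddAbove (πs s h)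
  have key1 : ∀ n h : ℕ, h + n = H → ∀ s, Vpi H P r πs h s = U n s := by
    intro n
    induction n with
    | zero =>
      intro h hh s
      obtain rfl : h = H := by omega
      rw [aux_Vpi_top, hU0]
    | succ n ih =>
      intro h hh s
      rw [aux_Vpi_lt H P r πs (by omega), hUs n h hh]
      simp only [ih (h + 1) (by omega)]
  refine ⟨πs, ?_⟩
  intro n
  induction n with
  | zero =>
    intro h hh s π
    obtain rfl : h = H := by omega
    rw [aux_Vpi_top, aux_Vpi_top]
  | succ n ih =>
    intro h hh s π
    have hlt : h < H := by omega
    have e2 : H - (h + 1) = n := by omega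
    have h1 := hπs s h (π s h)
    rw [e2] at h1
    rw [key1 _ h hh, hUs n h hh, aux_Vpi_lt H P r π hlt]
    refine le_trans ?_ h1
    have := aux_mono (hP h hlt s (π s h)).1
      (fun s' => (ih (h + 1) (by omega) s' π).trans_eq (key1 n (h + 1) (by omega) s'))
    linarith
end mdp

/-- **Correctness of QVI-4 (deterministic core).**
If all mean estimates meet their error guarantees, then the outputs
`π̂ := π_{K−1}`, `V̂_h := V_{K−1,h}`, `Q̂_h := Q_{K−1,h}` satisfy
`V⋆_h − ε ≤ V̂_h ≤ V^{π̂}_h ≤ V⋆_h` and `Q⋆_h − ε ≤ Q̂_h ≤ Q^{π̂}_h ≤ Q⋆_h`. -/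
theorem qvi4_correct
{S A : Type*} [Fintype S] [Fintype A] [Nonempty S] [Nonempty A]
    (H : ℕ) (hH : 0 < H)
    (P : ℕ → S → A → S → ℝ) (r : ℕ → S → A → ℝ)
    (hP : ∀ h < H, ∀ (s : S) (a : A), (∀ s' : S, 0 ≤ P h s a s') ∧ ∑ s' : S, P h s a s' = 1)
    (hr : ∀ h < H, ∀ (s : S) (a : A), 0 ≤ r h s a ∧ r h s a ≤ 1)
    (ε : ℝ) (hε : 0 < ε) (hεH : ε ≤ Real.sqrt H)
    (K : ℕ) (hK : K = ⌈Real.logb 2 (H / ε)⌉₊ + 1)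
    (y x g : ℕ → ℕ → S → A → ℝ)
    (V V0 : ℕ → ℕ → S → ℝ) (Vt : ℕ → ℕ → S → ℝ) (Q : ℕ → ℕ → S → A → ℝ)
    (πk π0 πt : ℕ → S → ℕ → A)
    -- QVI-4 iterate structure
    (hV00 : ∀ h ≤ H, ∀ s : S, V0 0 h s = 0)
    (hVkH : ∀ k < K, ∀ s : S, V k H s = 0)
    (hV0kH : ∀ k < K, ∀ s : S, V0 k H s = 0)
    (hy0 : ∀ k < K, ∀ h < H, ∀ (s : S) (a : A), 0 ≤ y k h s a)
    (hQdef : ∀ k < K, ∀ h < H, ∀ (s : S) (a : A),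
      Q k h s a = max (r h s a + x k h s a + g k h s a) 0)
    (hπt : ∀ k < K, ∀ h < H, ∀ (s : S) (a : A), Q k h s a ≤ Q k h s (πt k s h))
    (hVt : ∀ k < K, ∀ h < H, ∀ s : S, Vt k h s = Q k h s (πt k s h))
    (hupd₁ : ∀ k < K, ∀ h < H, ∀ s : S, V0 k h s < Vt k h s →
      V k h s = Vt k h s ∧ πk k s h = πt k s h)
    (hupd₂ : ∀ k < K, ∀ h < H, ∀ s : S, Vt k h s ≤ V0 k h s →
      V k h s = V0 k h s ∧ πk k s h = π0 k s h)
    (hnext : ∀ k, k + 1 < K → ∀ h < H, ∀ s : S,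
      V0 (k + 1) h s = V k h s ∧ π0 (k + 1) s h = πk k s h)
    -- estimate guarantees (with b = 1 and c = 0.001)
    (hy : ∀ k < K, ∀ h < H, ∀ (s : S) (a : A), ∃ E₁ E₂ : ℝ,
      |E₁ - ∑ s' : S, P h s a s' * V0 k (h + 1) s'| ≤ 1 / H ∧
      |E₂ - ∑ s' : S, P h s a s' * (V0 k (h + 1) s') ^ 2| ≤ 1 ∧
      y k h s a = max (E₂ - E₁ ^ 2) 0)
    (hx : ∀ k < K, ∀ h < H, ∀ (s : S) (a : A),
      |x k h s a + (0.001 * ε / (H : ℝ) ^ (1.5 : ℝ)) * Real.sqrt (y k h s a + 4 * 1)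
          - ∑ s' : S, P h s a s' * V0 k (h + 1) s'|
        ≤ (0.001 * ε / (H : ℝ) ^ (1.5 : ℝ)) * Real.sqrt (y k h s a + 4 * 1))
    (hg : ∀ k < K, ∀ h < H, ∀ (s : S) (a : A),
      |g k h s a + 0.001 * ((H : ℝ) / 2 ^ k) / H
          - ∑ s' : S, P h s a s' * (V k (h + 1) s' - V0 k (h + 1) s')|
        ≤ 0.001 * ((H : ℝ) / 2 ^ k) / H) :
    ∀ h < H,
      (∀ s : S,
        Vstar H P r h s - ε ≤ V (K - 1) h s ∧
        V (K - 1) h s ≤ Vpi H P r (πk (K - 1)) h s ∧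
        Vpi H P r (πk (K - 1)) h s ≤ Vstar H P r h s) ∧
      (∀ (s : S) (a : A),
        Qstar H P r h s a - ε ≤ Q (K - 1) h s a ∧
        Q (K - 1) h s a ≤ Qpi H P r (πk (K - 1)) h s a ∧
        Qpi H P r (πk (K - 1)) h s a ≤ Qstar H P r h s a) := by
  have hHr : (1 : ℝ) ≤ H := by exact_mod_cast hH
  have hH0 : (0 : ℝ) < H := by linarith
  obtain ⟨q, hqdef⟩ : ∃ q, q = Real.sqrt H := ⟨_, rfl⟩
  have hq1 : 1 ≤ q := by rw [hqdef]; exact Real.one_le_sqrt.2 hHr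
  have hq0 : 0 < q := by linarith
  have hqq : q * q = H := by rw [hqdef]; exact Real.mul_self_sqrt hH0.le
  rw [← hqdef] at hεH
  have hpow : (H : ℝ) ^ (1.5 : ℝ) = q ^ 3 := by
    have : (1.5 : ℝ) = 1 + 1 / 2 := by norm_num
    rw [this, Real.rpow_add hH0, Real.rpow_one, ← Real.sqrt_eq_rpow, ← hqdef, ← hqq]; ring
  -- optimal policy
  obtain ⟨πs, hopt'⟩ := aux_opt H P r hP
  have hopt : ∀ h ≤ H, ∀ s π, Vpi H P r π h s ≤ Vpi H P r πs h s :=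
    fun h hh => hopt' (H - h) h (by omega)
  have hbd : ∀ π : S → ℕ → A, ∀ h ≤ H, ∀ s, 0 ≤ Vpi H P r π h s ∧ Vpi H P r π h s ≤ H := by
    intro π h hh s
    obtain ⟨a, b⟩ := aux_Vpi_bd H P r hP hr π (H - h) h (by omega) s
    refine ⟨a, b.trans ?_⟩
    exact_mod_cast Nat.sub_le _ _
  have hVs : ∀ h ≤ H, ∀ s, Vstar H P r h s = Vpi H P r πs h s := by
    intro h hh s
    apply le_antisymm
    · have : Nonempty (S → ℕ → A) := ⟨πs⟩
      exact ciSup_le (hopt h hh s)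
    · exact le_ciSup (f := fun π => Vpi H P r π h s)
        ⟨_, by rintro _ ⟨π, rfl⟩; exact hopt h hh s π⟩ πs
  have hQo : ∀ h < H, ∀ s a π, Qpi H P r π h s a ≤ Qpi H P r πs h s a := by
    intro h hh s a π
    unfold Qpi
    have := aux_mono (hP h hh s a).1 (fun s' => hopt (h + 1) hh s' π)
    linarith
  have hQs : ∀ h < H, ∀ s a, Qstar H P r h s a = Qpi H P r πs h s a := by
    intro h hh s a
    apply le_antisymm
    · have : Nonempty (S → ℕ → A) := ⟨πs⟩
      exact ciSup_le (hQo h hh s a)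
    · exact le_ciSup (f := fun π => Qpi H P r π h s a)
        ⟨_, by rintro _ ⟨π, rfl⟩; exact hQo h hh s a π⟩ πs
  obtain ⟨W, hW⟩ : ∃ W : ℕ → S → ℝ, ∀ h s, Vpi H P r πs h s = W h s := ⟨_, fun _ _ => rfl⟩
  have hWlt : ∀ h < H, ∀ s, W h s = r h s (πs s h) + ∑ s', P h s (πs s h) s' * W (h + 1) s' := by
    intro h hh s
    rw [← hW, aux_Vpi_lt H P r πs hh]; simp only [hW]
  have hWH : ∀ s, W H s = 0 := fun s => by rw [← hW, aux_Vpi_top]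
  have hWbd : ∀ h ≤ H, ∀ s, 0 ≤ W h s ∧ W h s ≤ H := fun h hh s => by
    rw [← hW]; exact hbd πs h hh s
  -- the scale
  have hKk : ∀ k < K, ε ≤ 2 * ((H : ℝ) / 2 ^ k) := by
    intro k hk
    have hL : 0 ≤ Real.logb 2 (H / ε) := by
      apply Real.logb_nonneg (by norm_num)
      rw [le_div_iff₀ hε]; nlinarith
    have h1 : (k : ℝ) < Real.logb 2 (H / ε) + 1 := by
      have := Nat.ceil_lt_add_one hL
      have h2 : k ≤ ⌈Real.logb 2 (H / ε)⌉₊ := by omega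
      have h3 : (k : ℝ) ≤ (⌈Real.logb 2 (H / ε)⌉₊ : ℝ) := by exact_mod_cast h2
      linarith
    have h2 : (2 : ℝ) ^ ((k : ℝ) - 1) < H / ε := by
      rw [← Real.lt_logb_iff_rpow_lt (by norm_num) (by positivity)]; linarith
    rw [Real.rpow_sub (by norm_num), Real.rpow_natCast, Real.rpow_one, lt_div_iff₀ hε] at h2
    rw [← mul_div_assoc, le_div_iff₀ (by positivity)]
    linarith
  have hKl : (H : ℝ) / 2 ^ (K - 1) ≤ ε := by
    have h1 : Real.logb 2 (H / ε) ≤ ((K - 1 : ℕ) : ℝ) := by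
      have : K - 1 = ⌈Real.logb 2 (H / ε)⌉₊ := by omega
      rw [this]; exact Nat.le_ceil _
    rw [Real.logb_le_iff_le_rpow (by norm_num) (by positivity), Real.rpow_natCast,
      div_le_iff₀ hε] at h1
    rw [div_le_iff₀ (by positivity)]; linarith
  -- basic structure of the iterates
  have hVV0 : ∀ k < K, ∀ h ≤ H, ∀ s, V0 k h s ≤ V k h s := by
    intro k hk h hh s
    rcases hh.lt_or_eq with hlt | rfl
    · rcases lt_or_ge (V0 k h s) (Vt k h s) with c | c
      · rw [(hupd₁ k hk h hlt s c).1]; exact c.le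
      · rw [(hupd₂ k hk h hlt s c).1]
    · rw [hVkH k hk, hV0kH k hk]
  have hnextV : ∀ k, k + 1 < K → ∀ h ≤ H, ∀ s, V0 (k + 1) h s = V k h s := by
    intro k hk h hh s
    rcases hh.lt_or_eq with hlt | rfl
    · exact (hnext k hk h hlt s).1
    · rw [hVkH k (by omega), hV0kH _ hk]
  have hV0nn : ∀ k < K, ∀ h ≤ H, ∀ s, 0 ≤ V0 k h s := by
    intro k
    induction k with
    | zero => intro _ h hh s; rw [hV00 h hh s]
    | succ k ih =>
      intro hk h hh s
      rw [hnextV k hk h hh s]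
      exact (ih (by omega) h hh s).trans (hVV0 k (by omega) h hh s)
  have hVnn : ∀ k < K, ∀ h ≤ H, ∀ s, 0 ≤ V k h s := fun k hk h hh s =>
    (hV0nn k hk h hh s).trans (hVV0 k hk h hh s)
  have hsub : ∀ k h s a, ∑ s', P h s a s' * (V k (h + 1) s' - V0 k (h + 1) s') =
      ∑ s', P h s a s' * V k (h + 1) s' - ∑ s', P h s a s' * V0 k (h + 1) s' := by
    intro k h s a
    rw [← Finset.sum_sub_distrib]
    exact Finset.sum_congr rfl fun s' _ => by ring
  have hQup : ∀ k < K, ∀ h < H, ∀ s a,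
      Q k h s a ≤ r h s a + ∑ s', P h s a s' * V k (h + 1) s' := by
    intro k hk h hh s a
    rw [hQdef k hk h hh]
    have h1 := (abs_le.1 (hx k hk h hh s a)).2
    have h2 := (abs_le.1 (hg k hk h hh s a)).2
    rw [hsub] at h2
    have h3 := aux_nonneg (hP h hh s a).1 (fun s' => hVnn k hk (h + 1) hh s')
    have h4 := (hr h hh s a).1
    apply max_le <;> linarith
  have hT : ∀ k < K, ∀ h < H, ∀ s,
      V k h s ≤ r h s (πk k s h) + ∑ s', P h s (πk k s h) s' * V k (h + 1) s' := by
    intro k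
    induction k with
    | zero =>
      intro hk h hh s
      rcases lt_or_ge (V0 0 h s) (Vt 0 h s) with c | c
      · obtain ⟨c1, c2⟩ := hupd₁ 0 hk h hh s c
        rw [c1, c2, hVt 0 hk h hh]; exact hQup 0 hk h hh s _
      · rw [(hupd₂ 0 hk h hh s c).1, hV00 h hh.le]
        have h3 := aux_nonneg (hP h hh s (πk 0 s h)).1 (fun s' => hVnn 0 hk (h + 1) hh s')
        have h4 := (hr h hh s (πk 0 s h)).1
        linarith
    | succ k ih =>
      intro hk h hh s
      rcases lt_or_ge (V0 (k+1) h s) (Vt (k+1) h s) with c | c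
      · obtain ⟨c1, c2⟩ := hupd₁ (k+1) hk h hh s c
        rw [c1, c2, hVt (k+1) hk h hh]; exact hQup (k+1) hk h hh s _
      · obtain ⟨c1, c2⟩ := hupd₂ (k+1) hk h hh s c
        rw [c1, c2, (hnext k hk h hh s).1, (hnext k hk h hh s).2]
        refine (ih (by omega) h hh s).trans ?_
        have := aux_mono (hP h hh s (πk k s h)).1 (f := fun s' => V k (h + 1) s')
          (g := fun s' => V (k + 1) (h + 1) s') (fun s' => by
            rw [← hnextV k hk (h + 1) hh s']; exact hVV0 (k + 1) hk (h + 1) hh s')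
        linarith
  have hVle' : ∀ k < K, ∀ n h : ℕ, h + n = H → ∀ s, V k h s ≤ Vpi H P r (πk k) h s := by
    intro k hk n
    induction n with
    | zero =>
      intro h hh s
      obtain rfl : h = H := by omega
      rw [aux_Vpi_top, hVkH k hk]
    | succ n ih =>
      intro h hh s
      have hlt : h < H := by omega
      rw [aux_Vpi_lt H P r _ hlt]
      have := aux_mono (hP h hlt s (πk k s h)).1 (ih (h + 1) (by omega))
      linarith [hT k hk h hlt s]
  have hVle : ∀ k < K, ∀ h ≤ H, ∀ s, V k h s ≤ Vpi H P r (πk k) h s :=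
    fun k hk h hh => hVle' k hk (H - h) h (by omega)
  have hVW : ∀ k < K, ∀ h ≤ H, ∀ s, V k h s ≤ W h s := fun k hk h hh s => by
    rw [← hW]; exact (hVle k hk h hh s).trans (hopt h hh s _)
  have hV0W : ∀ k < K, ∀ h ≤ H, ∀ s, V0 k h s ≤ W h s := fun k hk h hh s =>
    (hVV0 k hk h hh s).trans (hVW k hk h hh s)
  -- one-step lower bound
  have hstep : ∀ k < K, (∀ h ≤ H, ∀ s, W h s - V0 k h s ≤ 2 * ((H : ℝ) / 2 ^ k)) →
      ∀ h < H, ∀ s a, r h s a + ∑ s', P h s a s' * V k (h + 1) s' - Q k h s a ≤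
        2 * (0.001 * ε / q ^ 3) * ((∑ s', P h s a s' * W (h + 1) s' ^ 2 -
          (∑ s', P h s a s' * W (h + 1) s') ^ 2) / q + q / 2 + 3 * ((H : ℝ) / 2 ^ k) + 3) +
        2 * (0.001 * ((H : ℝ) / 2 ^ k) / H) := by
    intro k hk hind h hh s a
    obtain ⟨E₁, E₂, hE1, hE2, hyE⟩ := hy k hk h hh s a
    have hs := aux_sqrt (hP h hh s a).1 (hP h hh s a).2 hHr
      (show (0 : ℝ) ≤ (H : ℝ) / 2 ^ k by positivity) hq0
      (hV0nn k hk (h + 1) hh) (hV0W k hk (h + 1) hh) (fun s => (hWbd (h + 1) hh s).2)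
      (hind (h + 1) hh) hE1 hE2
    rw [← hyE] at hs
    have h1 := (abs_le.1 (hx k hk h hh s a)).1
    have h2 := (abs_le.1 (hg k hk h hh s a)).1
    rw [hsub] at h2
    rw [hpow] at h1
    have h3 : r h s a + x k h s a + g k h s a ≤ Q k h s a := by
      rw [hQdef k hk h hh]; exact le_max_left _ _
    have h4 := mul_le_mul_of_nonneg_left hs (show 0 ≤ 0.001 * ε / q ^ 3 by positivity)
    linarith
  -- main induction inside a round
  have hround : ∀ k < K, (∀ h ≤ H, ∀ s, W h s - V0 k h s ≤ 2 * ((H : ℝ) / 2 ^ k)) →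
      ∀ h ≤ H, ∀ s, W h s - V k h s ≤ 0.03 * ((H : ℝ) / 2 ^ k) := by
    intro k hk hind
    have hst := hstep k hk hind
    have hek := hKk k hk
    have he0 : 0 < (H : ℝ) / 2 ^ k := by positivity
    generalize (H : ℝ) / 2 ^ k = e at *
    obtain ⟨β, hβ⟩ : ∃ β, β = 2 * (0.001 * ε / q ^ 3) / q := ⟨_, rfl⟩
    obtain ⟨α₀, hα₀⟩ : ∃ α₀, α₀ = 2 * (0.001 * ε / q ^ 3) * (q / 2 + 3 * e + 3) +
      2 * (0.001 * e / H) := ⟨_, rfl⟩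
    have hβ0 : 0 ≤ β := by rw [hβ]; positivity
    have hα0 : 0 ≤ α₀ := by rw [hα₀]; positivity
    have hind2 : ∀ n h : ℕ, h + n = H → ∀ s,
        W h s - V k h s ≤ n * (α₀ + 2 * H * β) - β * W h s ^ 2 := by
      intro n
      induction n with
      | zero =>
        intro h hh s
        obtain rfl : h = H := by omega
        rw [hWH, hVkH k hk]; simp
      | succ n ih =>
        intro h hh s
        have hlt : h < H := by omega
        have ih' := ih (h + 1) (by omega)
        have hp := hP h hlt s (πs s h)
        have hQV : Q k h s (πs s h) ≤ V k h s := by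
          refine (hπt k hk h hlt s _).trans ?_
          rw [← hVt k hk h hlt]
          rcases lt_or_ge (V0 k h s) (Vt k h s) with c | c
          · rw [(hupd₁ k hk h hlt s c).1]
          · rw [(hupd₂ k hk h hlt s c).1]; exact c
        have h1 := hst h hlt s (πs s h)
        have h2 := hWlt h hlt s
        have h3 : ∑ s', P h s (πs s h) s' * W (h + 1) s' - ∑ s', P h s (πs s h) s' * V k (h + 1) s'
            ≤ n * (α₀ + 2 * H * β) - β * ∑ s', P h s (πs s h) s' * W (h + 1) s' ^ 2 := by
          have := aux_le hp.1 hp.2 (f := fun s' => W (h + 1) s' - V k (h + 1) s' +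
            β * W (h + 1) s' ^ 2) (c := n * (α₀ + 2 * H * β)) (fun s' => by linarith [ih' s'])
          have e : ∑ s', P h s (πs s h) s' * (W (h + 1) s' - V k (h + 1) s' +
              β * W (h + 1) s' ^ 2) = ∑ s', P h s (πs s h) s' * W (h + 1) s' -
              ∑ s', P h s (πs s h) s' * V k (h + 1) s' +
              β * ∑ s', P h s (πs s h) s' * W (h + 1) s' ^ 2 := by
            rw [Finset.mul_sum, ← Finset.sum_sub_distrib, ← Finset.sum_add_distrib]
            exact Finset.sum_congr rfl fun s' _ => by ring
          linarith
        have hr1 := hr h hlt s (πs s h)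
        have hw := hWbd h hlt.le s
        have hm0 := aux_nonneg hp.1 (fun s' => (hWbd (h + 1) hlt s').1)
        generalize (∑ s', P h s (πs s h) s' * W (h + 1) s' ^ 2) = w2 at *
        generalize (∑ s', P h s (πs s h) s' * W (h + 1) s') = m at *
        generalize (∑ s', P h s (πs s h) s' * V k (h + 1) s') = v at *
        generalize r h s (πs s h) = ρ at *
        have e1 : 2 * (0.001 * ε / q ^ 3) * ((w2 - m ^ 2) / q + q / 2 + 3 * e + 3) +
            2 * (0.001 * e / H) = β * (w2 - m ^ 2) + α₀ := by
          rw [hβ, hα₀]; ring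
        rw [e1] at h1
        have h5 : W h s ^ 2 - 2 * H ≤ m ^ 2 := by
          have : m = W h s - ρ := by linarith
          rw [this]; nlinarith
        have h6 := mul_le_mul_of_nonneg_left h5 hβ0
        push_cast
        linarith
    have htot : H * (α₀ + 2 * H * β) ≤ 0.03 * e := by
      have e1 : H * (α₀ + 2 * H * β) = 0.001 * ε + 6 * 0.001 * e * (ε / q) +
          6 * 0.001 * ε * (1 / q) + 2 * 0.001 * e + 4 * 0.001 * ε := by
        rw [hα₀, hβ, ← hqq]; field_simp; ring
      have h1 : ε / q ≤ 1 := by rw [div_le_one hq0]; exact hεH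
      have h2 : 1 / q ≤ 1 := by rw [div_le_one hq0]; exact hq1
      have h3 := mul_le_mul_of_nonneg_left h1 he0.le
      have h4 := mul_le_mul_of_nonneg_left h2 hε.le
      rw [e1]; linarith
    intro h hh s
    have h1 := hind2 (H - h) h (by omega) s
    have h2 : ((H - h : ℕ) : ℝ) ≤ H := by exact_mod_cast Nat.sub_le _ _
    have h3 := mul_le_mul_of_nonneg_right h2 (show 0 ≤ α₀ + 2 * H * β by positivity)
    have h4 : 0 ≤ β * W h s ^ 2 := by positivity
    linarith
  have hprev : ∀ k < K, ∀ h ≤ H, ∀ s, W h s - V0 k h s ≤ 2 * ((H : ℝ) / 2 ^ k) := by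
    intro k
    induction k with
    | zero =>
      intro hk h hh s
      rw [hV00 h hh]
      have := hWbd h hh s
      norm_num; linarith
    | succ k ih =>
      intro hk h hh s
      rw [hnextV k hk h hh]
      have h1 := hround k (by omega) (ih (by omega)) h hh s
      have e : 2 * ((H : ℝ) / 2 ^ (k + 1)) = H / 2 ^ k := by
        rw [pow_succ]; field_simp
      have he0 : 0 < (H : ℝ) / 2 ^ k := by positivity
      rw [e]; linarith
  have hk : K - 1 < K := by omega
  have hfin := hround (K - 1) hk (hprev (K - 1) hk)
  intro h hh
  constructor
  · intro s
    rw [hVs h hh.le]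
    refine ⟨?_, hVle _ hk h hh.le s, hopt h hh.le s _⟩
    have := hfin h hh.le s
    rw [hW]; linarith
  · intro s a
    rw [hQs h hh]
    refine ⟨?_, ?_, hQo h hh s a _⟩
    · have h1 := hstep (K - 1) hk (hprev (K - 1) hk) h hh s a
      have he0 : 0 < (H : ℝ) / 2 ^ (K - 1) := by positivity
      have hp := hP h hh s a
      have h2 := aux_le hp.1 hp.2 (fun s' => hfin (h + 1) hh s')
      have e : ∑ s', P h s a s' * (W (h + 1) s' - V (K - 1) (h + 1) s') =
          ∑ s', P h s a s' * W (h + 1) s' - ∑ s', P h s a s' * V (K - 1) (h + 1) s' := by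
        rw [← Finset.sum_sub_distrib]
        exact Finset.sum_congr rfl fun s' _ => by ring
      rw [e] at h2
      have h3 : ∑ s', P h s a s' * W (h + 1) s' ^ 2 ≤ (H : ℝ) ^ 2 := aux_le hp.1 hp.2 fun s' => by
        have := hWbd (h + 1) hh s'
        nlinarith
      have h4 : ∑ s', P h s a s' * W (h + 1) s' ^ 2 - (∑ s', P h s a s' * W (h + 1) s') ^ 2
          ≤ (H : ℝ) ^ 2 := by nlinarith [sq_nonneg (∑ s', P h s a s' * W (h + 1) s')]
      unfold Qpi
      simp only [hW]
      generalize (∑ s', P h s a s' * W (h + 1) s' ^ 2 -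
        (∑ s', P h s a s' * W (h + 1) s') ^ 2) = v at *
      generalize (H : ℝ) / 2 ^ (K - 1) = e at *
      have h5 : 2 * (0.001 * ε / q ^ 3) * (v / q + q / 2 + 3 * e + 3) ≤ 0.1 * ε := by
        have hv : v / q ≤ q ^ 3 := by
          rw [div_le_iff₀ hq0]; rw [← hqq] at h4; linarith [h4]
        have hq3 : q ≤ q ^ 3 := by nlinarith
        have : v / q + q / 2 + 3 * e + 3 ≤ 8 * q ^ 3 := by linarith
        have h6 := mul_le_mul_of_nonneg_left this (show 0 ≤ 2 * (0.001 * ε / q ^ 3) by positivity)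
        have e3 : 2 * (0.001 * ε / q ^ 3) * (8 * q ^ 3) = 0.016 * ε := by
          field_simp; norm_num
        linarith
      have h6 : 0.001 * e / H ≤ 0.001 * ε := by
        rw [div_le_iff₀ hH0]; nlinarith
      linarith
    · refine (hQup _ hk h hh s a).trans ?_
      unfold Qpi
      have := aux_mono (hP h hh s a).1 (fun s' => hVle (K - 1) hk (h + 1) hh s')
      linarith
end

section
/- Variance proxy bounds: Let S be a finite nonempty set, p a probability distribution on S, H ≥ 1 an integer, V : S → [0, H], and set b = 1. Write μ = Σ_{s∈S} p(s)V(s), m₂ = Σ_{s∈S} p(s)V(s)², and σ² = m₂ − μ². Suppose Ê₁, Ê₂ ∈ R satisfy |Ê₁ − μ| ≤ b/H and |Ê₂ − m₂| ≤ b, and set y = max{Ê₂ − Ê₁², 0}. Then (i) σ² ≤ y + 4b, and (ii) y + 4b ≤ σ² + 7b, so that √(y + 4b) ≤ σ + √(7b) where σ = √(σ²). -/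
open Finset

/-- **Variance proxy bounds.**
Let `p` be a probability distribution on a finite nonempty set `S`, `H ≥ 1`,
`V : S → [0, H]`, and `b = 1`. If `Ê₁, Ê₂` estimate the mean `μ` and second moment `m₂`
to within `b/H` and `b` respectively, and `y = max (Ê₂ − Ê₁², 0)`, then
`σ² ≤ y + 4b`, `y + 4b ≤ σ² + 7b`, and `√(y + 4b) ≤ σ + √(7b)`. -/
theorem variance_proxy_bounds
    {S : Type*} [Fintype S] [Nonempty S]
    (p : S → ℝ) (hp0 : ∀ s : S, 0 ≤ p s) (hp1 : ∑ s : S, p s = 1)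
    (H : ℕ) (hH : 1 ≤ H)
    (V : S → ℝ) (hV : ∀ s : S, 0 ≤ V s ∧ V s ≤ H)
    (E₁ E₂ : ℝ)
    (hE₁ : |E₁ - ∑ s : S, p s * V s| ≤ 1 / H)
    (hE₂ : |E₂ - ∑ s : S, p s * (V s) ^ 2| ≤ 1) :
    let μ : ℝ := ∑ s : S, p s * V s
    let m₂ : ℝ := ∑ s : S, p s * (V s) ^ 2
    let var : ℝ := m₂ - μ ^ 2
    let y : ℝ := max (E₂ - E₁ ^ 2) 0
    var ≤ y + 4 * 1 ∧ y + 4 * 1 ≤ var + 7 * 1 ∧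
      Real.sqrt (y + 4 * 1) ≤ Real.sqrt var + Real.sqrt (7 * 1) := by
  intro μ m₂ var y
  have hH' : (1 : ℝ) ≤ H := by exact_mod_cast hH
  have hHpos : (0 : ℝ) < H := by linarith
  have hμ0 : 0 ≤ μ := Finset.sum_nonneg fun s _ => mul_nonneg (hp0 s) (hV s).1
  have hμH : μ ≤ H := by
    calc μ ≤ ∑ s : S, p s * (H : ℝ) :=
          Finset.sum_le_sum fun s _ => mul_le_mul_of_nonneg_left (hV s).2 (hp0 s)
      _ = H := by rw [← Finset.sum_mul, hp1, one_mul]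
  have hvar : 0 ≤ var := by
    have h : 0 ≤ ∑ s : S, p s * (V s - μ) ^ 2 :=
      Finset.sum_nonneg fun s _ => mul_nonneg (hp0 s) (sq_nonneg _)
    have h2 : ∑ s : S, p s * (V s - μ) ^ 2 = m₂ - 2 * μ * μ + μ ^ 2 * ∑ s : S, p s := by
      have : ∀ s, p s * (V s - μ) ^ 2 = p s * V s ^ 2 - 2 * μ * (p s * V s) + μ ^ 2 * p s := by
        intro s; ring
      simp only [this, Finset.sum_add_distrib, Finset.sum_sub_distrib, ← Finset.mul_sum]
      rfl
    rw [h2, hp1] at h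
    change 0 ≤ m₂ - μ ^ 2
    linarith [h, sq μ]
  change |E₁ - μ| ≤ 1 / H at hE₁
  change |E₂ - m₂| ≤ 1 at hE₂
  have hvd : var = m₂ - μ ^ 2 := rfl
  have hd1 : |E₁ - μ| ≤ 1 := hE₁.trans (by rw [div_le_one hHpos]; exact hH')
  have hprod : |μ * (E₁ - μ)| ≤ 1 := by
    rw [abs_mul, abs_of_nonneg hμ0]
    calc μ * |E₁ - μ| ≤ H * (1 / H) := mul_le_mul hμH hE₁ (abs_nonneg _) hHpos.le
      _ = 1 := by field_simp
  have hsq : (E₁ - μ) ^ 2 ≤ 1 := (sq_le_one_iff_abs_le_one _).2 hd1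
  have hsq0 := sq_nonneg (E₁ - μ)
  have hE : E₁ ^ 2 = μ ^ 2 + 2 * (μ * (E₁ - μ)) + (E₁ - μ) ^ 2 := by ring
  obtain ⟨a1, a2⟩ := abs_le.1 hprod
  obtain ⟨b1, b2⟩ := abs_le.1 hE₂
  have hy1 : E₂ - E₁ ^ 2 ≤ y := le_max_left _ _
  have hy2 : y ≤ var + 3 := max_le (by linarith) (by linarith)
  have hii : y + 4 * 1 ≤ var + 7 * 1 := by linarith
  refine ⟨by linarith, hii, (Real.sqrt_le_sqrt hii).trans ?_⟩
  rw [Real.sqrt_le_left (by positivity), add_sq, Real.sq_sqrt hvar,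
    Real.sq_sqrt (by norm_num)]
  have : 0 ≤ 2 * √var * √(7 * 1) := by positivity
  linarith
end

section
/- Iterative property of the value operator for QVI-5 (perturbed transitions): Under the QVI-5 construction, for every h ∈ {0,…,H−1}: T_{π̂}^h V̂_{h+1} − ε/H ≤ V̂_h ≤ T_{π̂}^h V̂_{h+1}, and V̂_h ≤ V_h^{π̂} ≤ V_h^* ≤ H (componentwise). -/
open Finset

variable {S A : Type*}

lemma Vpi_bounds {S A : Type*} [Fintype S] (H : ℕ)
    (P : ℕ → S → A → S → ℝ) (r : ℕ → S → A → ℝ)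
    (hP : ∀ h < H, ∀ (s : S) (a : A), (∀ s' : S, 0 ≤ P h s a s') ∧ ∑ s' : S, P h s a s' = 1)
    (hr : ∀ h < H, ∀ (s : S) (a : A), 0 ≤ r h s a ∧ r h s a ≤ 1) (π : S → ℕ → A) :
    ∀ k h : ℕ, h + k = H → ∀ s, Vpi H P r π h s ≤ k := by
  intro k
  induction k with
  | zero =>
    intro h hk s
    rw [Vpi, dif_neg (by omega)]
    simp
  | succ k ih =>
    intro h hk s
    have hlt : h < H := by omega
    rw [Vpi, dif_pos hlt]
    obtain ⟨h0, h1⟩ := hP h hlt s (π s h)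
    have : ∑ s' : S, P h s (π s h) s' * Vpi H P r π (h + 1) s'
        ≤ ∑ s' : S, P h s (π s h) s' * (k : ℝ) :=
      Finset.sum_le_sum fun s' _ =>
        mul_le_mul_of_nonneg_left (ih (h + 1) (by omega) s') (h0 s')
    rw [← Finset.sum_mul, h1] at this
    push_cast
    linarith [(hr h hlt s (π s h)).2]

lemma sum_close {S : Type*} [Fintype S] [Nonempty S] (H : ℝ) (hH : 0 < H) (ε : ℝ)
    (p q u : S → ℝ) (hpq : ∀ s, |q s - p s| ≤ ε / (4 * (Fintype.card S) * H ^ 2))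
    (hu : ∀ s, 0 ≤ u s ∧ u s ≤ H) :
    |∑ s, q s * u s - ∑ s, p s * u s| ≤ ε / (4 * H) := by
  rw [← Finset.sum_sub_distrib]
  calc |∑ s, (q s * u s - p s * u s)| ≤ ∑ s, |q s * u s - p s * u s| :=
        Finset.abs_sum_le_sum_abs _ _
    _ ≤ ∑ _s : S, ε / (4 * (Fintype.card S) * H ^ 2) * H := by
        refine Finset.sum_le_sum fun s _ => ?_
        rw [← sub_mul, abs_mul, abs_of_nonneg (hu s).1]
        exact mul_le_mul (hpq s) (hu s).2 (hu s).1 ((abs_nonneg _).trans (hpq s))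
    _ = ε / (4 * H) := by
        have : (Fintype.card S : ℝ) ≠ 0 := by exact_mod_cast Fintype.card_ne_zero
        rw [Finset.sum_const, Finset.card_univ, nsmul_eq_mul]
        field_simp

/-- **Iterative property of the value operator for QVI-5 (perturbed transitions).**
Under the QVI-5 construction,
`T_{π̂}^h V̂_{h+1} − ε/H ≤ V̂_h ≤ T_{π̂}^h V̂_{h+1}` and
`V̂_h ≤ V_h^{π̂} ≤ V_h^* ≤ H` componentwise, for every `h < H`. -/
theorem qvi5_iterative_property
{S A : Type*} [Fintype S] [Fintype A] [Nonempty S] [Nonempty A]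
    (H : ℕ) (hH : 0 < H)
    (P : ℕ → S → A → S → ℝ) (r : ℕ → S → A → ℝ)
    (hP : ∀ h < H, ∀ (s : S) (a : A), (∀ s' : S, 0 ≤ P h s a s') ∧ ∑ s' : S, P h s a s' = 1)
    (hr : ∀ h < H, ∀ (s : S) (a : A), 0 ≤ r h s a ∧ r h s a ≤ 1)
    (ε : ℝ) (hε : 0 < ε) (hεH : ε ≤ H)
    -- perturbed transition probabilities
    (P'' : ℕ → S → A → S → ℝ)
    (hP''01 : ∀ h < H, ∀ (s : S) (a : A) (s' : S), 0 ≤ P'' h s a s' ∧ P'' h s a s' ≤ 1)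
    (hP''close : ∀ h < H, ∀ (s : S) (a : A) (s' : S),
      |P'' h s a s' - P h s a s'| ≤ ε / (4 * (Fintype.card S) * H ^ 2))
    -- mean estimates and the resulting iterates
    (E : ℕ → S → A → ℝ) (z : ℕ → S → A → ℝ)
    (Qhat : ℕ → S → A → ℝ) (Vhat : ℕ → S → ℝ) (πhat : S → ℕ → A)
    (hVH : ∀ s : S, Vhat H s = 0)
    (hE : ∀ h < H, ∀ (s : S) (a : A),
      |E h s a - ∑ s' : S, P'' h s a s' * Vhat (h + 1) s'| ≤ ε / (4 * H))
    (hz : ∀ h < H, ∀ (s : S) (a : A), z h s a = E h s a - ε / (2 * H))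
    (hQdef : ∀ h < H, ∀ (s : S) (a : A), Qhat h s a = max (r h s a + z h s a) 0)
    (hmax : ∀ h < H, ∀ (s : S) (a : A), Qhat h s a ≤ Qhat h s (πhat s h))
    (hVdef : ∀ h < H, ∀ s : S, Vhat h s = Qhat h s (πhat s h)) :
    ∀ h < H, ∀ s : S,
      Tpol P r πhat h (Vhat (h + 1)) s - ε / H ≤ Vhat h s ∧
      Vhat h s ≤ Tpol P r πhat h (Vhat (h + 1)) s ∧
      Vhat h s ≤ Vpi H P r πhat h s ∧
      Vpi H P r πhat h s ≤ Vstar H P r h s ∧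
      Vstar H P r h s ≤ H := by
  have hHr : (0 : ℝ) < H := by exact_mod_cast hH
  have hVle : ∀ (π : S → ℕ → A) (h : ℕ), h ≤ H → ∀ s, Vpi H P r π h s ≤ H := by
    intro π h hh s
    refine (Vpi_bounds H P r hP hr π (H - h) h (by omega) s).trans ?_
    exact_mod_cast Nat.sub_le H h
  have step : ∀ h < H, (∀ s, 0 ≤ Vhat (h + 1) s ∧ Vhat (h + 1) s ≤ H) → ∀ s,
      0 ≤ Vhat h s ∧ Tpol P r πhat h (Vhat (h + 1)) s - ε / H ≤ Vhat h s ∧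
      Vhat h s ≤ Tpol P r πhat h (Vhat (h + 1)) s := by
    intro h hlt hu s
    have h1 := sum_close (H : ℝ) hHr ε (P h s (πhat s h)) (P'' h s (πhat s h)) (Vhat (h + 1))
      (hP''close h hlt s _) hu
    have h2 := hE h hlt s (πhat s h)
    rw [abs_le] at h1 h2
    have e1 : ε / (4 * (H : ℝ)) = ε / H / 4 := by field_simp
    have e2 : ε / (2 * (H : ℝ)) = ε / H / 2 := by field_simp
    have hT : 0 ≤ ∑ s' : S, P h s (πhat s h) s' * Vhat (h + 1) s' :=
      Finset.sum_nonneg fun s' _ => mul_nonneg ((hP h hlt s _).1 s') (hu s').1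
    have hr0 := (hr h hlt s (πhat s h)).1
    rw [hVdef h hlt, hQdef h hlt, hz h hlt, e2]
    rw [e1] at h1 h2
    unfold Tpol
    refine ⟨le_max_right _ _, le_max_of_le_left ?_, max_le ?_ ?_⟩ <;> linarith [h1.1, h1.2, h2.1, h2.2]
  have key : ∀ k h : ℕ, h + k = H → ∀ s, 0 ≤ Vhat h s ∧ Vhat h s ≤ Vpi H P r πhat h s := by
    intro k
    induction k with
    | zero =>
      intro h hk s
      obtain rfl : h = H := by omega
      rw [Vpi, dif_neg (by omega), hVH]
      simp
    | succ k ih =>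
      intro h hk s
      have hlt : h < H := by omega
      have ih' := ih (h + 1) (by omega)
      obtain ⟨a, -, c⟩ := step h hlt
        (fun s => ⟨(ih' s).1, (ih' s).2.trans (hVle _ _ (by omega) s)⟩) s
      refine ⟨a, c.trans ?_⟩
      rw [Vpi, dif_pos hlt, Tpol]
      gcongr with s' _
      · exact (hP h hlt s _).1 s'
      · exact (ih' s').2
  intro h hlt s
  have ih' := key (H - (h + 1)) (h + 1) (by omega)
  obtain ⟨-, b, c⟩ := step h hlt
    (fun s => ⟨(ih' s).1, (ih' s).2.trans (hVle _ _ (by omega) s)⟩) s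
  refine ⟨b, c, (key (H - h) h (by omega) s).2, ?_, ?_⟩
  · exact le_ciSup (f := fun π : S → ℕ → A => Vpi H P r π h s)
      ⟨(H : ℝ), by rintro _ ⟨π, rfl⟩; exact hVle π h hlt.le s⟩ πhat
  · exact ciSup_le fun π => hVle π h hlt.le s
end

section
/- Correctness of QVI-5 (deterministic core, assuming all mean estimates meet their error guarantees): Under the QVI-5 construction, for every h ∈ {0,…,H−1}: V_h^* − ε ≤ V̂_h ≤ V_h^{π̂} ≤ V_h^* (componentwise). -/
open Finset

variable {S A : Type*}

/-- **Correctness of QVI-5 (deterministic core).**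
Under the QVI-5 construction, for every `h < H`:
`V_h^* − ε ≤ V̂_h ≤ V_h^{π̂} ≤ V_h^*` componentwise. -/
theorem qvi5_correct
{S A : Type*} [Fintype S] [Fintype A] [Nonempty S] [Nonempty A]
    (H : ℕ) (hH : 0 < H)
    (P : ℕ → S → A → S → ℝ) (r : ℕ → S → A → ℝ)
    (hP : ∀ h < H, ∀ (s : S) (a : A), (∀ s' : S, 0 ≤ P h s a s') ∧ ∑ s' : S, P h s a s' = 1)
    (hr : ∀ h < H, ∀ (s : S) (a : A), 0 ≤ r h s a ∧ r h s a ≤ 1)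
    (ε : ℝ) (hε : 0 < ε) (hεH : ε ≤ H)
    -- perturbed transition probabilities
    (P'' : ℕ → S → A → S → ℝ)
    (hP''01 : ∀ h < H, ∀ (s : S) (a : A) (s' : S), 0 ≤ P'' h s a s' ∧ P'' h s a s' ≤ 1)
    (hP''close : ∀ h < H, ∀ (s : S) (a : A) (s' : S),
      |P'' h s a s' - P h s a s'| ≤ ε / (4 * (Fintype.card S) * H ^ 2))
    -- mean estimates and the resulting iterates
    (E : ℕ → S → A → ℝ) (z : ℕ → S → A → ℝ)
    (Qhat : ℕ → S → A → ℝ) (Vhat : ℕ → S → ℝ) (πhat : S → ℕ → A)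
    (hVH : ∀ s : S, Vhat H s = 0)
    (hE : ∀ h < H, ∀ (s : S) (a : A),
      |E h s a - ∑ s' : S, P'' h s a s' * Vhat (h + 1) s'| ≤ ε / (4 * H))
    (hz : ∀ h < H, ∀ (s : S) (a : A), z h s a = E h s a - ε / (2 * H))
    (hQdef : ∀ h < H, ∀ (s : S) (a : A), Qhat h s a = max (r h s a + z h s a) 0)
    (hmax : ∀ h < H, ∀ (s : S) (a : A), Qhat h s a ≤ Qhat h s (πhat s h))
    (hVdef : ∀ h < H, ∀ s : S, Vhat h s = Qhat h s (πhat s h)) :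
    ∀ h < H, ∀ s : S,
      Vstar H P r h s - ε ≤ Vhat h s ∧
      Vhat h s ≤ Vpi H P r πhat h s ∧
      Vpi H P r πhat h s ≤ Vstar H P r h s := by
  have hHR : (0:ℝ) < H := by exact_mod_cast hH
  have hSR : (0:ℝ) < Fintype.card S := by exact_mod_cast Fintype.card_pos
  have unf : ∀ (π : S → ℕ → A) (h : ℕ), h < H → ∀ s, Vpi H P r π h s =
      r h s (π s h) + ∑ s' : S, P h s (π s h) s' * Vpi H P r π (h + 1) s' := by
    intro π h hh s
    rw [Vpi, dif_pos hh]
  have unfH : ∀ (π : S → ℕ → A) (s : S), Vpi H P r π H s = 0 := by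
    intro π s
    rw [Vpi, dif_neg (lt_irrefl H)]
  -- monotonicity of the expectation, with an additive slack
  have mono : ∀ h < H, ∀ (s : S) (a : A) (u v : S → ℝ) (c : ℝ), (∀ s', u s' ≤ v s' + c) →
      ∑ s', P h s a s' * u s' ≤ ∑ s', P h s a s' * v s' + c := by
    intro h hh s a u v c huv
    obtain ⟨h0, h1⟩ := hP h hh s a
    calc ∑ s', P h s a s' * u s' ≤ ∑ s', P h s a s' * (v s' + c) :=
          Finset.sum_le_sum fun s' _ => mul_le_mul_of_nonneg_left (huv s') (h0 s')
      _ = ∑ s', P h s a s' * v s' + c := by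
          simp only [mul_add, Finset.sum_add_distrib, ← Finset.sum_mul, h1, one_mul]
  have ub : ∀ (π : S → ℕ → A) (k h : ℕ), h + k = H → ∀ s, Vpi H P r π h s ≤ k := by
    intro π k
    induction k with
    | zero =>
      intro h hk s
      obtain rfl : h = H := by omega
      simp [unfH]
    | succ k ih =>
      intro h hk s
      have hh : h < H := by omega
      rw [unf π h hh s]
      have h1 := mono h hh s (π s h) (Vpi H P r π (h+1)) (fun _ => 0) k
        (fun s' => by simpa using ih (h+1) (by omega) s')
      have h2 := (hr h hh s (π s h)).2
      simp only [mul_zero, Finset.sum_const_zero] at h1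
      push_cast
      linarith
  -- accuracy of z
  have acc : ∀ h < H, (∀ s', 0 ≤ Vhat (h+1) s' ∧ Vhat (h+1) s' ≤ H) → ∀ (s : S) (a : A),
      z h s a ≤ ∑ s', P h s a s' * Vhat (h+1) s' ∧
      ∑ s', P h s a s' * Vhat (h+1) s' - ε / H ≤ z h s a := by
    intro h hh hV s a
    have h1 : |∑ s', P'' h s a s' * Vhat (h+1) s' - ∑ s', P h s a s' * Vhat (h+1) s'|
        ≤ ε / (4 * H) := by
      rw [← Finset.sum_sub_distrib]
      calc |∑ s', (P'' h s a s' * Vhat (h+1) s' - P h s a s' * Vhat (h+1) s')|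
          ≤ ∑ s', |P'' h s a s' * Vhat (h+1) s' - P h s a s' * Vhat (h+1) s'| :=
            Finset.abs_sum_le_sum_abs _ _
        _ ≤ ∑ _s' : S, ε / (4 * (Fintype.card S) * H ^ 2) * H := by
            refine Finset.sum_le_sum fun s' _ => ?_
            rw [← sub_mul, abs_mul, abs_of_nonneg (hV s').1]
            exact mul_le_mul (hP''close h hh s a s') (hV s').2 (hV s').1 (by positivity)
        _ = ε / (4 * H) := by
            rw [Finset.sum_const, Finset.card_univ, nsmul_eq_mul]
            field_simp
    have h2 := hE h hh s a
    rw [abs_le] at h1 h2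
    rw [hz h hh s a]
    have e1 : ε / (2 * H) = 2 * (ε / (4 * H)) := by field_simp; norm_num
    have e2 : ε / H = 4 * (ε / (4 * H)) := by field_simp
    rw [e1, e2]
    constructor <;> linarith [h1.1, h1.2, h2.1, h2.2]
  have main : ∀ (k h : ℕ), h + k = H → ∀ s, 0 ≤ Vhat h s ∧
      Vhat h s ≤ Vpi H P r πhat h s ∧ ∀ π, Vpi H P r π h s ≤ Vhat h s + k * (ε / H) := by
    intro k
    induction k with
    | zero =>
      intro h hk s
      obtain rfl : h = H := by omega
      simp [unfH, hVH]
    | succ k ih =>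
      intro h hk s
      have hh : h < H := by omega
      have ih' := ih (h+1) (by omega)
      have hkH : (k:ℝ) ≤ H := by exact_mod_cast (by omega : k ≤ H)
      have A1 := acc h hh (fun s' => ⟨(ih' s').1,
        ((ih' s').2.1.trans (ub πhat k (h+1) (by omega) s')).trans hkH⟩) s
      refine ⟨?_, ?_, ?_⟩
      · rw [hVdef h hh, hQdef h hh]; exact le_max_right _ _
      · rw [hVdef h hh, hQdef h hh, unf πhat h hh]
        have h1 := mono h hh s (πhat s h) (Vhat (h+1)) (Vpi H P r πhat (h+1)) 0
          (fun s' => by simpa using (ih' s').2.1)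
        have h0 := (hP h hh s (πhat s h)).1
        have h2 : 0 ≤ ∑ s', P h s (πhat s h) s' * Vhat (h+1) s' :=
          Finset.sum_nonneg fun s' _ => mul_nonneg (h0 s') (ih' s').1
        have h3 := (hr h hh s (πhat s h)).1
        have h4 := (A1 (πhat s h)).1
        apply max_le <;> linarith
      · intro π
        rw [unf π h hh, hVdef h hh]
        have h1 := mono h hh s (π s h) (Vpi H P r π (h+1)) (Vhat (h+1)) (k * (ε / H))
          (fun s' => (ih' s').2.2 π)
        have h2 := (A1 (π s h)).2
        have h3 := hmax h hh s (π s h)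
        have h4 : r h s (π s h) + z h s (π s h) ≤ Qhat h s (π s h) := by
          rw [hQdef h hh]; exact le_max_left _ _
        push_cast
        linarith
  intro h hh s
  have hk : h + (H - h) = H := by omega
  obtain ⟨_, m2, m3⟩ := main (H - h) h hk s
  refine ⟨?_, m2, ?_⟩
  · have hle : ((H - h : ℕ) : ℝ) * (ε / H) ≤ ε := by
      have : ((H - h : ℕ) : ℝ) ≤ H := by exact_mod_cast Nat.sub_le H h
      calc ((H - h : ℕ) : ℝ) * (ε / H) ≤ H * (ε / H) :=
            mul_le_mul_of_nonneg_right this (by positivity)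
        _ = ε := by field_simp
    have : Vstar H P r h s ≤ Vhat h s + ε := by
      unfold Vstar
      exact ciSup_le fun π => (m3 π).trans (by linarith)
    linarith
  · unfold Vstar
    exact le_ciSup (f := fun π : S → ℕ → A => Vpi H P r π h s)
      ⟨((H - h : ℕ) : ℝ), by rintro _ ⟨π, rfl⟩; exact ub π (H - h) h hk s⟩ πhat
end
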